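/- arXiv:1007.2248 — 7 statements merged into one kernel-verified Lean document; each statement's English description precedes it below -/
import Mathlib

section
/- Let G be an m×n XOR game. Then there exist nonnegative real constants c_1,…,c_m (the marginal row biases of G) such that: (a) for every ε with 0 ≤ ε < 1/(4(m+n)) and every ε-optimal vector strategy {u_i},{v_j} of G, one has ‖∑_{j=1}^n G_{ij} v_j − c_i u_i‖ ≤ √10 · (m+n)^{1/4} · ε^{1/4} for all 1 ≤ i ≤ m; and (b) if the i-th row of G is not identically zero, then c_i > 0. -/
open scoped BigOperators RealInnerProductSpace
open Matrix Kronecker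

noncomputable section

/-- An XOR game is given by a cost matrix whose absolute entries sum to 1. -/
def isXORGame {ι κ : Type*} [Fintype ι] [Fintype κ] (G : Matrix ι κ ℝ) : Prop :=
  ∑ i, ∑ j, |G i j| = 1

/-- The bias of a vector strategy. -/
def stratBias {ι κ : Type*} [Fintype ι] [Fintype κ] (G : Matrix ι κ ℝ) {N : ℕ}
    (u : ι → EuclideanSpace ℝ (Fin N)) (v : κ → EuclideanSpace ℝ (Fin N)) : ℝ :=
  ∑ i, ∑ j, G i j * ⟪u i, v j⟫

/-- The quantum bias of an XOR game: supremum of biases of vector strategies. -/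
def quantumBias {ι κ : Type*} [Fintype ι] [Fintype κ] (G : Matrix ι κ ℝ) : ℝ :=
  sSup {b : ℝ | ∃ (N : ℕ) (u : ι → EuclideanSpace ℝ (Fin N))
      (v : κ → EuclideanSpace ℝ (Fin N)),
    (∀ i, ‖u i‖ = 1) ∧ (∀ j, ‖v j‖ = 1) ∧ stratBias G u v = b}

/-- Objective function of the optimization problem (Γ). -/
def gammaObj {ι κ : Type*} [Fintype ι] [Fintype κ] (G : Matrix ι κ ℝ)
    (V : Matrix κ κ ℝ) : ℝ :=
  ∑ i, Real.sqrt (∑ j, ∑ k, G i j * G i k * V j k)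

/-- `V` is an optimal solution of (Γ). -/
def gammaOptimal {ι κ : Type*} [Fintype ι] [Fintype κ] (G : Matrix ι κ ℝ)
    (V : Matrix κ κ ℝ) : Prop :=
  V.PosSemidef ∧ (∀ j, V j j = 1) ∧
    ∀ W : Matrix κ κ ℝ, W.PosSemidef → (∀ j, W j j = 1) → gammaObj G W ≤ gammaObj G V

/-- `c` is the family of marginal row biases of `G`. -/
def isMarginalRowBiases {ι κ : Type*} [Fintype ι] [Fintype κ] (G : Matrix ι κ ℝ)
    (c : ι → ℝ) : Prop :=
  (∀ i, 0 ≤ c i) ∧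
  ∀ (N : ℕ) (u : ι → EuclideanSpace ℝ (Fin N)) (v : κ → EuclideanSpace ℝ (Fin N)),
    (∀ i, ‖u i‖ = 1) → (∀ j, ‖v j‖ = 1) → stratBias G u v = quantumBias G →
    ∀ i, ∑ j, G i j * ⟪u i, v j⟫ = c i

/-- `d` is the family of marginal column biases of `G`. -/
def isMarginalColBiases {ι κ : Type*} [Fintype ι] [Fintype κ] (G : Matrix ι κ ℝ)
    (d : κ → ℝ) : Prop :=
  (∀ j, 0 ≤ d j) ∧
  ∀ (N : ℕ) (u : ι → EuclideanSpace ℝ (Fin N)) (v : κ → EuclideanSpace ℝ (Fin N)),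
    (∀ i, ‖u i‖ = 1) → (∀ j, ‖v j‖ = 1) → stratBias G u v = quantumBias G →
    ∀ j, ∑ i, G i j * ⟪u i, v j⟫ = d j

/-- Hermitian inner product on `ι → ℂ`. -/
def cinner {ι : Type*} [Fintype ι] (x y : ι → ℂ) : ℂ := ∑ i, star (x i) * y i

/-- Hilbert space norm on `ι → ℂ`. -/
def cnorm {ι : Type*} [Fintype ι] (x : ι → ℂ) : ℝ := Real.sqrt (∑ i, ‖x i‖ ^ 2)

/-- Frobenius norm of a complex matrix. -/
def frobNorm {ι κ : Type*} [Fintype ι] [Fintype κ] (M : Matrix ι κ ℂ) : ℝ :=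
  Real.sqrt (∑ i, ∑ j, ‖M i j‖ ^ 2)

/-- Operator norm of a complex square matrix. -/
def opNorm {ι : Type*} [Fintype ι] [DecidableEq ι] (M : Matrix ι ι ℂ) : ℝ :=
  ‖Matrix.toEuclideanCLM (𝕜 := ℂ) M‖

/-- Bias of a quantum strategy. -/
def qStratBias {ι κ : Type*} [Fintype ι] [Fintype κ] {d₁ d₂ : ℕ} (G : Matrix ι κ ℝ)
    (A : ι → Matrix (Fin d₁) (Fin d₁) ℂ) (B : κ → Matrix (Fin d₂) (Fin d₂) ℂ)
    (ψ : Fin d₁ × Fin d₂ → ℂ) : ℂ :=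
  ∑ i, ∑ j, (G i j : ℂ) * cinner ψ ((A i ⊗ₖ B j).mulVec ψ)

/-- Nondegeneracy of a quantum strategy. -/
def Nondegenerate {ι κ : Type*} {d₁ d₂ : ℕ}
    (A : ι → Matrix (Fin d₁) (Fin d₁) ℂ) (B : κ → Matrix (Fin d₂) (Fin d₂) ℂ)
    (ψ : Fin d₁ × Fin d₂ → ℂ) : Prop :=
  (¬ ∃ P : Matrix (Fin d₁) (Fin d₁) ℂ, P ≠ 1 ∧ P.IsHermitian ∧ P * P = P ∧
      (∀ i, P * A i = A i * P) ∧ (P ⊗ₖ (1 : Matrix (Fin d₂) (Fin d₂) ℂ)).mulVec ψ = ψ) ∧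
  (¬ ∃ Q : Matrix (Fin d₂) (Fin d₂) ℂ, Q ≠ 1 ∧ Q.IsHermitian ∧ Q * Q = Q ∧
      (∀ j, Q * B j = B j * Q) ∧ ((1 : Matrix (Fin d₁) (Fin d₁) ℂ) ⊗ₖ Q).mulVec ψ = ψ)

section GramMaximizer

variable {κ : Type*} [Fintype κ]

open scoped MatrixOrder Matrix.Norms.L2Operator in
/-- Finitely many vectors of an inner product space can be realized, up to isometry, in the
Euclidean space whose dimension is the number of vectors. -/
lemma exists_euclidean_inner_eq {E : Type*} [NormedAddCommGroup E] [InnerProductSpace ℝ E]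
    (y : κ → E) :
    ∃ x : κ → EuclideanSpace ℝ (Fin (Fintype.card κ)), ∀ k l, ⟪x k, x l⟫ = ⟪y k, y l⟫ := by
  classical
  obtain ⟨B, hB⟩ :=
    CStarAlgebra.nonneg_iff_eq_star_mul_self.mp (Matrix.posSemidef_gram ℝ y).nonneg
  refine ⟨fun k => WithLp.toLp 2 fun p => B ((Fintype.equivFin κ).symm p) k, fun k l => ?_⟩
  have h := congrFun (congrFun hB k) l
  rw [Matrix.gram_apply, Matrix.star_eq_conjTranspose, Matrix.mul_apply] at h
  rw [h, PiLp.inner_apply, ← (Fintype.equivFin κ).symm.sum_comp]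
  simp [mul_comm]

lemma norm_eq_one_of_inner_self {E : Type*} [NormedAddCommGroup E] [InnerProductSpace ℝ E]
    {x : E} (h : ⟪x, x⟫ = (1 : ℝ)) : ‖x‖ = 1 := by
  rw [real_inner_self_eq_norm_sq] at h
  nlinarith [norm_nonneg x]

lemma exists_gram_maximizer (S : Matrix κ κ ℝ) :
    ∃ x : κ → EuclideanSpace ℝ (Fin (Fintype.card κ)), (∀ k, ‖x k‖ = 1) ∧
      ∀ {E : Type} [NormedAddCommGroup E] [InnerProductSpace ℝ E] (y : κ → E),
        (∀ k, ‖y k‖ = 1) →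
          ∑ k, ∑ l, S k l * ⟪y k, y l⟫ ≤ ∑ k, ∑ l, S k l * ⟪x k, x l⟫ := by
  let T : Set (κ → EuclideanSpace ℝ (Fin (Fintype.card κ))) :=
    Set.univ.pi fun _ => Metric.sphere 0 1
  have hT : ∀ x, x ∈ T ↔ ∀ k, ‖x k‖ = 1 := fun x => by simp [T]
  have hTc : IsCompact T := isCompact_univ_pi fun _ => isCompact_sphere 0 1
  have transfer : ∀ {E : Type} [NormedAddCommGroup E] [InnerProductSpace ℝ E] (y : κ → E),
      (∀ k, ‖y k‖ = 1) → ∃ x ∈ T, ∀ k l, ⟪x k, x l⟫ = ⟪y k, y l⟫ := by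
    intro E _ _ y hy
    obtain ⟨x, hx⟩ := exists_euclidean_inner_eq y
    refine ⟨x, (hT x).2 fun k => norm_eq_one_of_inner_self ?_, hx⟩
    rw [hx, real_inner_self_eq_norm_sq, hy, one_pow]
  have hTn : T.Nonempty := by
    obtain ⟨x, hx, -⟩ := transfer (fun _ : κ => (1 : ℝ)) (by simp)
    exact ⟨x, hx⟩
  obtain ⟨x, hx, hmax⟩ := hTc.exists_isMaxOn hTn
    (f := fun x => ∑ k, ∑ l, S k l * ⟪x k, x l⟫) (by fun_prop)
  refine ⟨x, (hT x).1 hx, fun y hy => ?_⟩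
  obtain ⟨z, hz, hzy⟩ := transfer y hy
  simpa only [hzy, Set.mem_ofPred_eq] using hmax hz

lemma hasDerivAt_sqrt_one_sub_mul (r : ℝ) :
    HasDerivAt (fun s : ℝ => √(1 - s * r)) (-r / 2) 0 := by
  have h := (((hasDerivAt_id (0 : ℝ)).mul_const r).const_sub 1).sqrt (by simp)
  simpa using h

/-- Second-order optimality condition, obtained by rotating the maximizing vectors towards a
common new direction. -/
lemma gram_maximizer_quadratic_le {S : Matrix κ κ ℝ} (hS : S.IsSymm) {N : ℕ}
    {x : κ → EuclideanSpace ℝ (Fin N)} (hx : ∀ k, ‖x k‖ = 1)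
    (hmax : ∀ {E : Type} [NormedAddCommGroup E] [InnerProductSpace ℝ E] (y : κ → E),
      (∀ k, ‖y k‖ = 1) → ∑ k, ∑ l, S k l * ⟪y k, y l⟫ ≤ ∑ k, ∑ l, S k l * ⟪x k, x l⟫)
    (a : κ → ℝ) :
    ∑ k, ∑ l, S k l * (a k * a l) ≤ ∑ k, (∑ l, S k l * ⟪x k, x l⟫) * a k ^ 2 := by
  let f : ℝ → ℝ := fun s => ∑ k, ∑ l, S k l *
    (√(1 - s * a k ^ 2) * √(1 - s * a l ^ 2) * ⟪x k, x l⟫ + s * (a k * a l))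
  have hf0 : f 0 = ∑ k, ∑ l, S k l * ⟪x k, x l⟫ := by simp [f]
  have hder : HasDerivAt f (∑ k, ∑ l, S k l *
      ((-a k ^ 2 / 2 + -a l ^ 2 / 2) * ⟪x k, x l⟫ + a k * a l)) 0 := by
    refine HasDerivAt.fun_sum fun k _ => HasDerivAt.fun_sum fun l _ => ?_
    have h := ((((hasDerivAt_sqrt_one_sub_mul (a k ^ 2)).mul
      (hasDerivAt_sqrt_one_sub_mul (a l ^ 2))).mul_const ⟪x k, x l⟫).add
      ((hasDerivAt_id (0 : ℝ)).mul_const (a k * a l))).const_mul (S k l)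
    simpa [Pi.mul_def, Pi.add_def] using h
  have hsmall : ∀ᶠ s : ℝ in nhdsWithin 0 (Set.Ioi 0), ∀ k, 0 ≤ 1 - s * a k ^ 2 := by
    refine Filter.eventually_all.2 fun k => Filter.Eventually.filter_mono nhdsWithin_le_nhds ?_
    have hc : Continuous fun s : ℝ => 1 - s * a k ^ 2 := by fun_prop
    exact (hc.continuousAt.eventually (lt_mem_nhds (by simp))).mono fun s hs => le_of_lt hs
  have hle : ∀ᶠ s : ℝ in nhdsWithin 0 (Set.Ioi 0), s⁻¹ • (f (0 + s) - f 0) ≤ 0 := by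
    filter_upwards [hsmall, self_mem_nhdsWithin] with s hs (hs0 : 0 < s)
    let y : κ → WithLp 2 (EuclideanSpace ℝ (Fin N) × ℝ) := fun k =>
      WithLp.toLp 2 (√(1 - s * a k ^ 2) • x k, √s * a k)
    have hyi : ∀ k l, ⟪y k, y l⟫ =
        √(1 - s * a k ^ 2) * √(1 - s * a l ^ 2) * ⟪x k, x l⟫ + s * (a k * a l) := by
      intro k l
      have h1 : √s * √s = s := Real.mul_self_sqrt hs0.le
      simp only [y, WithLp.prod_inner_apply, inner_smul_left, inner_smul_right, conj_trivial,
        RCLike.inner_apply]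
      linear_combination (a k * a l) * h1
    have hy : ∀ k, ‖y k‖ = 1 := fun k => by
      refine norm_eq_one_of_inner_self ?_
      rw [hyi, real_inner_self_eq_norm_sq, hx, Real.mul_self_sqrt (hs k)]
      ring
    have h := hmax y hy
    simp only [hyi] at h
    rw [zero_add, hf0]
    exact mul_nonpos_of_nonneg_of_nonpos (inv_nonneg.2 hs0.le) (sub_nonpos.2 h)
  have hd := le_of_tendsto hder.tendsto_slope_zero_right hle
  have hswap : ∑ k, ∑ l, S k l * (-a l ^ 2 / 2 * ⟪x k, x l⟫) =
      ∑ k, ∑ l, S k l * (-a k ^ 2 / 2 * ⟪x k, x l⟫) := by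
    rw [Finset.sum_comm]
    refine Finset.sum_congr rfl fun k _ => Finset.sum_congr rfl fun l _ => ?_
    rw [hS.apply k l, real_inner_comm]
  have hsum : ∑ k, (∑ l, S k l * ⟪x k, x l⟫) * a k ^ 2 =
      - (∑ k, ∑ l, S k l * (-a k ^ 2 / 2 * ⟪x k, x l⟫) +
        ∑ k, ∑ l, S k l * (-a k ^ 2 / 2 * ⟪x k, x l⟫)) := by
    simp only [Finset.sum_mul, ← Finset.sum_add_distrib, ← Finset.sum_neg_distrib]
    refine Finset.sum_congr rfl fun k _ => Finset.sum_congr rfl fun l _ => ?_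
    ring
  simp only [add_mul, mul_add, Finset.sum_add_distrib, hswap] at hd
  linarith

end GramMaximizer

section DualCertificate

variable {ι κ : Type*} [Fintype ι] [Fintype κ] {G : Matrix ι κ ℝ}

lemma bddAbove_stratBias (G : Matrix ι κ ℝ) :
    BddAbove {b : ℝ | ∃ (N : ℕ) (u : ι → EuclideanSpace ℝ (Fin N))
      (v : κ → EuclideanSpace ℝ (Fin N)),
      (∀ i, ‖u i‖ = 1) ∧ (∀ j, ‖v j‖ = 1) ∧ stratBias G u v = b} := by
  refine ⟨∑ i, ∑ j, |G i j|, ?_⟩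
  rintro _ ⟨N, u, v, hu, hv, rfl⟩
  refine Finset.sum_le_sum fun i _ => Finset.sum_le_sum fun j _ => ?_
  refine (le_abs_self _).trans ?_
  rw [abs_mul]
  refine mul_le_of_le_one_right (abs_nonneg _) ?_
  simpa [hu, hv] using abs_real_inner_le_norm (u i) (v j)

/-- An optimal dual solution of the semidefinite program defining the quantum bias. -/
lemma exists_dual_certificate (hG : isXORGame G) :
    ∃ (c : ι → ℝ) (d : κ → ℝ), (∀ i, c i ≤ 1) ∧
      (∑ i, c i + ∑ j, d j ≤ 2 * quantumBias G) ∧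
      ∀ (a : ι → ℝ) (b : κ → ℝ), 2 * ∑ i, ∑ j, G i j * (a i * b j) ≤
        ∑ i, c i * a i ^ 2 + ∑ j, d j * b j ^ 2 := by
  have hS : (Matrix.fromBlocks 0 G Gᵀ 0).IsSymm := by
    simp [Matrix.IsSymm, Matrix.fromBlocks_transpose]
  obtain ⟨x, hx, hmax⟩ := exists_gram_maximizer (Matrix.fromBlocks 0 G Gᵀ 0)
  have hquad := gram_maximizer_quadratic_le hS hx hmax
  simp only [Fintype.sum_sum_type, Matrix.fromBlocks_apply₁₁, Matrix.fromBlocks_apply₁₂,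
    Matrix.fromBlocks_apply₂₁, Matrix.fromBlocks_apply₂₂, Matrix.zero_apply, zero_mul,
    Finset.sum_const_zero, zero_add, add_zero, Matrix.transpose_apply] at hquad
  refine ⟨fun i => ∑ j, G i j * ⟪x (.inl i), x (.inr j)⟫,
    fun j => ∑ i, G i j * ⟪x (.inr j), x (.inl i)⟫, fun i => ?_, ?_, fun a b => ?_⟩
  · calc ∑ j, G i j * ⟪x (.inl i), x (.inr j)⟫ ≤ ∑ j, |G i j| := by
          refine Finset.sum_le_sum fun j _ => (le_abs_self _).trans ?_
          rw [abs_mul]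
          refine mul_le_of_le_one_right (abs_nonneg _) ?_
          simpa [hx] using abs_real_inner_le_norm (x (.inl i)) (x (.inr j))
      _ ≤ ∑ i, ∑ j, |G i j| :=
          Finset.single_le_sum (f := fun i => ∑ j, |G i j|)
            (fun _ _ => Finset.sum_nonneg fun _ _ => abs_nonneg _) (Finset.mem_univ i)
      _ = 1 := hG
  · have h : stratBias G (fun i => x (.inl i)) (fun j => x (.inr j)) ≤ quantumBias G :=
      le_csSup (bddAbove_stratBias G) ⟨_, _, _, fun _ => hx _, fun _ => hx _, rfl⟩
    have hswap : ∑ j, ∑ i, G i j * ⟪x (.inr j), x (.inl i)⟫ =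
        ∑ i, ∑ j, G i j * ⟪x (.inl i), x (.inr j)⟫ := by
      rw [Finset.sum_comm]
      simp only [real_inner_comm]
    simp only [stratBias] at h
    linarith
  · have h := hquad (Sum.elim a b)
    simp only [Sum.elim_inl, Sum.elim_inr] at h
    have hswap : ∑ j, ∑ i, G i j * (b j * a i) = ∑ i, ∑ j, G i j * (a i * b j) := by
      rw [Finset.sum_comm]
      simp only [mul_comm]
    linarith

variable {c : ι → ℝ} {d : κ → ℝ}

lemma sum_mul_norm_sq (e : ι → ℝ) {N : ℕ} (w : ι → EuclideanSpace ℝ (Fin N)) :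
    ∑ i, e i * ‖w i‖ ^ 2 = ∑ p, ∑ i, e i * w i p ^ 2 := by
  rw [Finset.sum_comm]
  simp [EuclideanSpace.norm_sq_eq, Finset.mul_sum]

/-- A scalar dual certificate bounds the bilinear form on vectors as well. -/
lemma two_mul_stratBias_le
    (h : ∀ (a : ι → ℝ) (b : κ → ℝ), 2 * ∑ i, ∑ j, G i j * (a i * b j) ≤
      ∑ i, c i * a i ^ 2 + ∑ j, d j * b j ^ 2)
    {N : ℕ} (u : ι → EuclideanSpace ℝ (Fin N)) (v : κ → EuclideanSpace ℝ (Fin N)) :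
    2 * stratBias G u v ≤ ∑ i, c i * ‖u i‖ ^ 2 + ∑ j, d j * ‖v j‖ ^ 2 := by
  have hsum := Finset.sum_le_sum fun p (_ : p ∈ Finset.univ) =>
    h (fun i => u i p) (fun j => v j p)
  have h1 : stratBias G u v = ∑ p, ∑ i, ∑ j, G i j * (u i p * v j p) := by
    rw [Finset.sum_comm, stratBias]
    refine Finset.sum_congr rfl fun i _ => ?_
    rw [Finset.sum_comm]
    refine Finset.sum_congr rfl fun j _ => ?_
    simp [PiLp.inner_apply, Finset.mul_sum, mul_comm]
  rw [h1, sum_mul_norm_sq, sum_mul_norm_sq, ← Finset.sum_add_distrib, Finset.mul_sum]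
  exact hsum

/-- Complementary slackness: the rows of a nearly optimal strategy nearly satisfy the
stationarity equations. -/
lemma sq_norm_row_sub_le (hc : ∀ i, c i ≤ 1)
    (h : ∀ (a : ι → ℝ) (b : κ → ℝ), 2 * ∑ i, ∑ j, G i j * (a i * b j) ≤
      ∑ i, c i * a i ^ 2 + ∑ j, d j * b j ^ 2)
    {N : ℕ} {u : ι → EuclideanSpace ℝ (Fin N)} {v : κ → EuclideanSpace ℝ (Fin N)}
    (hu : ∀ i, ‖u i‖ = 1) (hv : ∀ j, ‖v j‖ = 1) (i : ι) :
    ‖(∑ j, G i j • v j) - c i • u i‖ ^ 2 ≤ ∑ i, c i + ∑ j, d j - 2 * stratBias G u v := by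
  classical
  set w := (∑ j, G i j • v j) - c i • u i with hw
  have hrow : ∀ z : EuclideanSpace ℝ (Fin N),
      ∑ j, G i j * ⟪z, v j⟫ = ⟪z, ∑ j, G i j • v j⟫ := fun z => by
    simp [inner_sum, inner_smul_right]
  have hbias : stratBias G (u + Pi.single i w) v =
      stratBias G u v + ⟪w, ∑ j, G i j • v j⟫ := by
    rw [← hrow]
    simp only [stratBias, Pi.add_apply, inner_add_left, mul_add, Finset.sum_add_distrib]
    congr 1
    rw [Finset.sum_eq_single i (fun k _ hk => by simp [Pi.single_eq_of_ne hk]) (by simp)]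
    simp
  have hnorm : ∑ k, c k * ‖(u + Pi.single i w : ι → EuclideanSpace ℝ (Fin N)) k‖ ^ 2 =
      ∑ k, c k + c i * (2 * ⟪w, u i⟫ + ‖w‖ ^ 2) := by
    have hk : ∀ k, c k * ‖(u + Pi.single i w : ι → EuclideanSpace ℝ (Fin N)) k‖ ^ 2 =
        c k + if k = i then c i * (2 * ⟪w, u i⟫ + ‖w‖ ^ 2) else 0 := by
      intro k
      split_ifs with hki
      · subst hki
        rw [Pi.add_apply, Pi.single_eq_same, norm_add_sq_real, hu, real_inner_comm]
        ring
      · simp [Pi.single_eq_of_ne hki, hu]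
    simp only [hk, Finset.sum_add_distrib, Finset.sum_ite_eq', Finset.mem_univ, if_true]
  have hmain := two_mul_stratBias_le h (u + Pi.single i w) v
  rw [hbias, hnorm] at hmain
  simp only [hv, one_pow, mul_one] at hmain
  have hww : ‖w‖ ^ 2 = ⟪w, ∑ j, G i j • v j⟫ - c i * ⟪w, u i⟫ := by
    rw [← real_inner_self_eq_norm_sq]
    nth_rewrite 2 [hw]
    rw [inner_sub_right, inner_smul_right]
  nlinarith [mul_le_mul_of_nonneg_right (hc i) (sq_nonneg ‖w‖)]

lemma dual_certificate_nonneg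
    (h : ∀ (a : ι → ℝ) (b : κ → ℝ), 2 * ∑ i, ∑ j, G i j * (a i * b j) ≤
      ∑ i, c i * a i ^ 2 + ∑ j, d j * b j ^ 2) (i : ι) : 0 ≤ c i := by
  classical
  simpa [Pi.single_apply] using h (Pi.single i 1) 0

lemma dual_certificate_pos
    (h : ∀ (a : ι → ℝ) (b : κ → ℝ), 2 * ∑ i, ∑ j, G i j * (a i * b j) ≤
      ∑ i, c i * a i ^ 2 + ∑ j, d j * b j ^ 2) {i : ι} {j : κ} (hij : G i j ≠ 0) : 0 < c i := by
  classical
  refine lt_of_le_of_ne (dual_certificate_nonneg h i) fun hci => ?_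
  have key : ∀ s : ℝ, 2 * (G i j * s) ≤ d j := fun s => by
    simpa [Pi.single_apply, ← hci] using h (Pi.single i s) (Pi.single j 1)
  have := key ((|d j| + 1) / G i j)
  rw [mul_div_cancel₀ _ hij] at this
  nlinarith [le_abs_self (d j), abs_nonneg (d j)]

end DualCertificate

/-- Theorem: existence of marginal row biases, quantitative form.
For every XOR game `G` there are nonnegative constants `c i` such that every
`ε`-optimal vector strategy (`0 ≤ ε < 1/(4(m+n))`) satisfies
`‖∑ j G i j • v j − c i • u i‖ ≤ √10 (m+n)^(1/4) ε^(1/4)`, and `c i > 0` whenever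
the `i`-th row of `G` is nonzero. -/
theorem marginal_row_biases_exist {m n : ℕ} (G : Matrix (Fin m) (Fin n) ℝ)
    (hG : isXORGame G) :
    ∃ c : Fin m → ℝ,
      (∀ i, 0 ≤ c i) ∧
      (∀ ε : ℝ, 0 ≤ ε → ε < 1 / (4 * (m + n)) →
        ∀ (N : ℕ) (u : Fin m → EuclideanSpace ℝ (Fin N))
          (v : Fin n → EuclideanSpace ℝ (Fin N)),
          (∀ i, ‖u i‖ = 1) → (∀ j, ‖v j‖ = 1) →
          quantumBias G - ε ≤ stratBias G u v →
          ∀ i, ‖(∑ j, G i j • v j) - c i • u i‖ ≤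
            Real.sqrt 10 * ((m + n : ℝ)) ^ ((1 : ℝ)/4) * ε ^ ((1 : ℝ)/4)) ∧
      (∀ i, (∃ j, G i j ≠ 0) → 0 < c i) := by
  obtain ⟨c, d, hc, hcd, h⟩ := exists_dual_certificate hG
  refine ⟨c, dual_certificate_nonneg h, fun ε hε hε' N u v hu hv hopt i => ?_,
    fun i ⟨j, hij⟩ => dual_certificate_pos h hij⟩
  have hmn : (1 : ℝ) ≤ m + n := by exact_mod_cast (i.pos.trans_le (Nat.le_add_right m n))
  have hε1 : ε ≤ 1 := hε'.le.trans (div_le_one_of_le₀ (by linarith) (by linarith))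
  have hsq := sq_norm_row_sub_le hc h hu hv i
  calc ‖(∑ j, G i j • v j) - c i • u i‖ ≤ √(10 * ε) := Real.le_sqrt_of_sq_le (by linarith)
    _ = √10 * 1 * ε ^ ((1 : ℝ) / 2) := by
        rw [Real.sqrt_mul (by norm_num), mul_one, Real.sqrt_eq_rpow ε]
    _ ≤ √10 * (m + n : ℝ) ^ ((1 : ℝ) / 4) * ε ^ ((1 : ℝ) / 4) :=
        mul_le_mul
          (mul_le_mul_of_nonneg_left (Real.one_le_rpow hmn (by norm_num)) (Real.sqrt_nonneg _))
          (Real.rpow_le_rpow_of_exponent_ge' hε hε1 (by norm_num) (by norm_num))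
          (by positivity) (by positivity)
end
end

section
/- Let G be an m×n XOR game with no zero rows, with marginal row biases c_1,…,c_m. Let v_1,…,v_n be unit vectors in ℝ^N with Gram matrix V, V_{jk} = ⟨v_j, v_k⟩. Then there exist N' ≥ N and unit vectors u_1,…,u_m in ℝ^{N'} such that {u_i},{v_j} (with each v_j viewed in ℝ^{N'} under the standard embedding) is an optimal vector strategy for G if and only if V is an optimal solution of (Γ). Moreover, if V is an optimal solution of (Γ), then c_i² = ∑_{j,k} G_{ij} G_{ik} V_{jk} for all 1 ≤ i ≤ m. -/
open scoped BigOperators RealInnerProductSpace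
open Matrix Kronecker

noncomputable section

/-- Standard embedding `ℝ^N → ℝ^N'` for `N ≤ N'` (extend by zeros). -/
def embedEuclidean {N N' : ℕ} (h : N ≤ N') (x : EuclideanSpace ℝ (Fin N)) :
    EuclideanSpace ℝ (Fin N') :=
  (WithLp.equiv 2 (Fin N' → ℝ)).symm (fun k => if hk : (k : ℕ) < N then x ⟨k, hk⟩ else 0)

theorem inner_embedEuclidean {N N' : ℕ} (h : N ≤ N') (x y : EuclideanSpace ℝ (Fin N)) :
    ⟪embedEuclidean h x, embedEuclidean h y⟫ = ⟪x, y⟫ := by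
  obtain ⟨d, rfl⟩ := Nat.exists_eq_add_of_le h
  simp [embedEuclidean, PiLp.inner_apply, Fin.sum_univ_add]

theorem norm_embedEuclidean {N N' : ℕ} (h : N ≤ N') (x : EuclideanSpace ℝ (Fin N)) :
    ‖embedEuclidean h x‖ = ‖x‖ := by
  rw [norm_eq_sqrt_real_inner, inner_embedEuclidean, ← norm_eq_sqrt_real_inner]

theorem exists_norm_one_inner_eq_norm {E : Type*} [NormedAddCommGroup E] [InnerProductSpace ℝ E]
    [Nontrivial E] (w : E) : ∃ u : E, ‖u‖ = 1 ∧ ⟪u, w⟫ = ‖w‖ := by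
  by_cases hw : w = 0
  · obtain ⟨u, hu⟩ := exists_norm_eq E zero_le_one
    exact ⟨u, hu, by simp [hw]⟩
  · have hw' : ‖w‖ ≠ 0 := norm_ne_zero_iff.mpr hw
    refine ⟨‖w‖⁻¹ • w, by simp [norm_smul, hw'], ?_⟩
    rw [real_inner_smul_left, real_inner_self_eq_norm_sq]
    field_simp

theorem Matrix.PosSemidef.exists_gram_eq {n : ℕ} {W : Matrix (Fin n) (Fin n) ℝ}
    (hW : W.PosSemidef) : ∃ (d : ℕ) (v : Fin n → EuclideanSpace ℝ (Fin d)), gram ℝ v = W := by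
  obtain ⟨d, x, rfl⟩ := Matrix.posSemidef_iff_eq_sum_vecMulVec.mp hW
  refine ⟨d, fun j => WithLp.toLp 2 fun k => x k j, ?_⟩
  ext i j
  simp [gram_apply, PiLp.inner_apply, Matrix.sum_apply, vecMulVec_apply, mul_comm]

section Strategy

variable {m n N : ℕ} (G : Matrix (Fin m) (Fin n) ℝ)

theorem sum_mul_gram_eq_norm_sq (v : Fin n → EuclideanSpace ℝ (Fin N)) (i : Fin m) :
    ∑ j, ∑ k, G i j * G i k * gram ℝ v j k = ‖∑ j, G i j • v j‖ ^ 2 := by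
  simp only [← real_inner_self_eq_norm_sq, sum_inner, inner_sum, real_inner_smul_left,
    real_inner_smul_right, gram_apply, mul_assoc]
  exact Finset.sum_congr rfl fun j _ => Finset.sum_congr rfl fun k _ => by
    rw [real_inner_comm]

theorem gammaObj_gram (v : Fin n → EuclideanSpace ℝ (Fin N)) :
    gammaObj G (gram ℝ v) = ∑ i, ‖∑ j, G i j • v j‖ := by
  simp only [gammaObj, sum_mul_gram_eq_norm_sq, Real.sqrt_sq (norm_nonneg _)]

theorem sum_mul_inner_eq (u : EuclideanSpace ℝ (Fin N)) (v : Fin n → EuclideanSpace ℝ (Fin N))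
    (i : Fin m) : ∑ j, G i j * ⟪u, v j⟫ = ⟪u, ∑ j, G i j • v j⟫ := by
  simp [inner_sum, real_inner_smul_right]

theorem stratBias_le_gammaObj_gram {u : Fin m → EuclideanSpace ℝ (Fin N)}
    (hu : ∀ i, ‖u i‖ = 1) (v : Fin n → EuclideanSpace ℝ (Fin N)) :
    stratBias G u v ≤ gammaObj G (gram ℝ v) := by
  rw [gammaObj_gram, stratBias]
  refine Finset.sum_le_sum fun i _ => ?_
  rw [sum_mul_inner_eq]
  simpa [hu i] using real_inner_le_norm (u i) (∑ j, G i j • v j)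

theorem stratBias_le_quantumBias {u : Fin m → EuclideanSpace ℝ (Fin N)}
    {v : Fin n → EuclideanSpace ℝ (Fin N)} (hu : ∀ i, ‖u i‖ = 1) (hv : ∀ j, ‖v j‖ = 1) :
    stratBias G u v ≤ quantumBias G := by
  refine le_csSup ⟨∑ i, ∑ j, |G i j|, ?_⟩ ⟨N, u, v, hu, hv, rfl⟩
  rintro _ ⟨N', u', v', hu', hv', rfl⟩
  refine Finset.sum_le_sum fun i _ => Finset.sum_le_sum fun j _ => (le_abs_self _).trans ?_
  rw [abs_mul]
  refine mul_le_of_le_one_right (abs_nonneg _) ?_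
  simpa [hu', hv'] using abs_real_inner_le_norm (u' i) (v' j)

theorem gram_embedEuclidean {N' : ℕ} (h : N ≤ N') (v : Fin n → EuclideanSpace ℝ (Fin N)) :
    gram ℝ (fun j => embedEuclidean h (v j)) = gram ℝ v := by
  ext i j
  simp [gram_apply, inner_embedEuclidean]

/-- One extra dimension provides unit vectors aligned with every row vector `∑ j, G i j • v j`,
even when these vanish. -/
theorem exists_aligned_strategy (v : Fin n → EuclideanSpace ℝ (Fin N)) :
    ∃ u : Fin m → EuclideanSpace ℝ (Fin (N + 1)), (∀ i, ‖u i‖ = 1) ∧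
      (∀ i, ∑ j, G i j * ⟪u i, embedEuclidean N.le_succ (v j)⟫ =
        √(∑ j, ∑ k, G i j * G i k * gram ℝ v j k)) ∧
      stratBias G u (fun j => embedEuclidean N.le_succ (v j)) = gammaObj G (gram ℝ v) := by
  choose u hu huw using fun i =>
    exists_norm_one_inner_eq_norm (∑ j, G i j • embedEuclidean N.le_succ (v j))
  have key : ∀ i, ∑ j, G i j * ⟪u i, embedEuclidean N.le_succ (v j)⟫ =
      √(∑ j, ∑ k, G i j * G i k * gram ℝ v j k) := fun i => by
    rw [sum_mul_inner_eq G (u i) (fun j => embedEuclidean N.le_succ (v j)), huw,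
      ← gram_embedEuclidean N.le_succ, sum_mul_gram_eq_norm_sq, Real.sqrt_sq (norm_nonneg _)]
  exact ⟨u, hu, key, Finset.sum_congr rfl fun i _ => key i⟩

theorem gammaObj_gram_le_quantumBias {v : Fin n → EuclideanSpace ℝ (Fin N)}
    (hv : ∀ j, ‖v j‖ = 1) : gammaObj G (gram ℝ v) ≤ quantumBias G := by
  obtain ⟨u, hu, -, hb⟩ := exists_aligned_strategy G v
  exact hb ▸ stratBias_le_quantumBias G hu fun j => (norm_embedEuclidean _ _).trans (hv j)

theorem gammaObj_le_quantumBias {W : Matrix (Fin n) (Fin n) ℝ} (hW : W.PosSemidef)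
    (hW1 : ∀ j, W j j = 1) : gammaObj G W ≤ quantumBias G := by
  obtain ⟨d, w, rfl⟩ := hW.exists_gram_eq
  refine gammaObj_gram_le_quantumBias G fun j => ?_
  rw [norm_eq_sqrt_real_inner, ← gram_apply, hW1, Real.sqrt_one]

theorem gammaOptimal_gram_iff {v : Fin n → EuclideanSpace ℝ (Fin N)} (hv : ∀ j, ‖v j‖ = 1) :
    gammaOptimal G (gram ℝ v) ↔ gammaObj G (gram ℝ v) = quantumBias G := by
  refine ⟨fun ⟨_, _, hmax⟩ => (gammaObj_gram_le_quantumBias G hv).antisymm ?_, fun h =>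
    ⟨posSemidef_gram ℝ v, fun j => by simp [gram_apply, hv],
      fun W hW hW1 => h ▸ gammaObj_le_quantumBias G hW hW1⟩⟩
  obtain ⟨u, hu, -, -⟩ := exists_aligned_strategy G v
  refine csSup_le ⟨_, _, u, fun j => embedEuclidean N.le_succ (v j), hu,
    fun j => (norm_embedEuclidean _ _).trans (hv j), rfl⟩ ?_
  rintro _ ⟨N', u', v', hu', hv', rfl⟩
  exact (stratBias_le_gammaObj_gram G hu' v').trans
    (hmax _ (posSemidef_gram ℝ v') fun j => by simp [gram_apply, hv'])

end Strategy

/-- for an XOR game `G` with no zero rows, with marginal row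
biases `c`, and unit vectors `v j` with Gram matrix `V`: there are `N' ≥ N` and
unit vectors `u i` in `ℝ^{N'}` making `{u i},{v j}` (with `v` embedded) an optimal
vector strategy iff `V` is an optimal solution of (Γ); moreover if `V` is optimal
for (Γ) then `c i ^ 2 = ∑ j k, G i j * G i k * V j k`. -/
theorem gram_opt_iff_gamma_opt {m n N : ℕ} (G : Matrix (Fin m) (Fin n) ℝ)
    (hG : isXORGame G) (hrows : ∀ i, ∃ j, G i j ≠ 0)
    (c : Fin m → ℝ) (hc : isMarginalRowBiases G c)
    (v : Fin n → EuclideanSpace ℝ (Fin N)) (hv : ∀ j, ‖v j‖ = 1)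
    (V : Matrix (Fin n) (Fin n) ℝ) (hV : ∀ j k, V j k = ⟪v j, v k⟫) :
    ((∃ (N' : ℕ) (hN : N ≤ N') (u : Fin m → EuclideanSpace ℝ (Fin N')),
        (∀ i, ‖u i‖ = 1) ∧
        stratBias G u (fun j => embedEuclidean hN (v j)) = quantumBias G) ↔
      gammaOptimal G V) ∧
    (gammaOptimal G V → ∀ i, c i ^ 2 = ∑ j, ∑ k, G i j * G i k * V j k) := by
  obtain rfl : V = gram ℝ v := by
    ext j k
    exact hV j k
  rw [gammaOptimal_gram_iff G hv]
  obtain ⟨u, hu, hrow, hbias⟩ := exists_aligned_strategy G v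
  refine ⟨⟨fun ⟨N', hN, u', hu', hopt⟩ => ?_, fun h => ⟨N + 1, N.le_succ, u, hu, hbias.trans h⟩⟩,
    fun h i => ?_⟩
  · refine (gammaObj_gram_le_quantumBias G hv).antisymm ?_
    rw [← hopt, ← gram_embedEuclidean hN v]
    exact stratBias_le_gammaObj_gram G hu' _
  · rw [← hc.2 (N + 1) u _ hu (fun j => (norm_embedEuclidean _ _).trans (hv j))
      (hbias.trans h) i, hrow, Real.sq_sqrt]
    rw [sum_mul_gram_eq_norm_sq]
    positivity
end
end

section
/- Let A be a self-adjoint d₁×d₁ complex matrix and B a self-adjoint d₂×d₂ complex matrix. Let λ be a d₂×d₁ complex matrix with ‖λ‖_F = 1, and let ψ = ∑_{i=1}^{d₁} e_i ⊗ (λ e_i) ∈ ℂ^{d₁} ⊗ ℂ^{d₂} (so ψ is a unit vector). Then ‖(A ⊗ I − I ⊗ B) ψ‖ = ‖λ Ā − B λ‖_F, where Ā denotes the entrywise complex conjugate of A. Consequently, if ‖(A ⊗ I − I ⊗ B) ψ‖ ≤ ε, then the density matrix ρ = λ λᴴ satisfies ‖ρ B − B ρ‖_F ≤ 2ε. -/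
open scoped BigOperators RealInnerProductSpace
open Matrix Kronecker

noncomputable section

section Frobenius

attribute [local instance] Matrix.frobeniusNormedAddCommGroup

theorem frobNorm_eq_norm {ι κ : Type*} [Fintype ι] [Fintype κ] (M : Matrix ι κ ℂ) :
    frobNorm M = ‖M‖ := by
  rw [frobNorm, Matrix.frobenius_norm_def, Real.sqrt_eq_rpow]
  simp

theorem frobNorm_sub_le {ι κ : Type*} [Fintype ι] [Fintype κ] (M N : Matrix ι κ ℂ) :
    frobNorm (M - N) ≤ frobNorm M + frobNorm N := by
  simpa only [frobNorm_eq_norm] using norm_sub_le M N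

theorem frobNorm_mul_le {ι κ μ : Type*} [Fintype ι] [Fintype κ] [Fintype μ]
    (M : Matrix ι κ ℂ) (N : Matrix κ μ ℂ) :
    frobNorm (M * N) ≤ frobNorm M * frobNorm N := by
  simpa only [frobNorm_eq_norm] using Matrix.frobenius_norm_mul M N

theorem frobNorm_conjTranspose {ι κ : Type*} [Fintype ι] [Fintype κ] (M : Matrix ι κ ℂ) :
    frobNorm Mᴴ = frobNorm M := by
  simpa only [frobNorm_eq_norm] using Matrix.frobenius_norm_conjTranspose M

end Frobenius

/-- The Hilbert space norm of a vectorized matrix is its Frobenius norm. -/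
theorem cnorm_vec {ι κ : Type*} [Fintype ι] [Fintype κ] (M : Matrix ι κ ℂ) :
    cnorm (Matrix.vec M) = frobNorm M := by
  simp only [cnorm, frobNorm, Matrix.vec, Fintype.sum_prod_type]
  rw [Finset.sum_comm]

theorem Matrix.IsHermitian.map_conj {ι : Type*} {A : Matrix ι ι ℂ} (hA : A.IsHermitian) :
    A.map (starRingEnd ℂ) = Aᵀ := by
  ext i j
  exact hA.apply j i

theorem kronecker_sub_mulVec_vec {ι κ : Type*} [Fintype ι] [Fintype κ] [DecidableEq ι]
    [DecidableEq κ] {A : Matrix ι ι ℂ} (hA : A.IsHermitian) (B : Matrix κ κ ℂ)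
    (M : Matrix κ ι ℂ) :
    (A ⊗ₖ (1 : Matrix κ κ ℂ) - (1 : Matrix ι ι ℂ) ⊗ₖ B).mulVec (Matrix.vec M)
      = Matrix.vec (M * A.map (starRingEnd ℂ) - B * M) := by
  rw [hA.map_conj, Matrix.sub_mulVec, Matrix.kronecker_mulVec_vec,
    Matrix.kronecker_mulVec_vec, Matrix.vec_sub]
  simp

/-- The commutator of `M * Mᴴ` with a Hermitian `B` in terms of the defect `M * A - B * M`. -/
theorem frobNorm_commutator_le {ι κ : Type*} [Fintype ι] [Fintype κ] {A : Matrix ι ι ℂ}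
    (hA : A.IsHermitian) {B : Matrix κ κ ℂ} (hB : B.IsHermitian) (M : Matrix κ ι ℂ) :
    frobNorm (M * Mᴴ * B - B * (M * Mᴴ)) ≤ 2 * (frobNorm (M * A - B * M) * frobNorm M) := by
  have h : M * Mᴴ * B - B * (M * Mᴴ) = (M * A - B * M) * Mᴴ - M * (M * A - B * M)ᴴ := by
    rw [Matrix.conjTranspose_sub, Matrix.conjTranspose_mul, Matrix.conjTranspose_mul,
      hA.eq, hB.eq]
    simp only [Matrix.sub_mul, Matrix.mul_sub, Matrix.mul_assoc]
    abel
  have h₁ := frobNorm_mul_le (M * A - B * M) Mᴴ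
  have h₂ := frobNorm_mul_le M (M * A - B * M)ᴴ
  rw [frobNorm_conjTranspose] at h₁ h₂
  rw [h]
  linarith [frobNorm_sub_le ((M * A - B * M) * Mᴴ) (M * (M * A - B * M)ᴴ)]

/-- Lemma on tensor commutation: with `ψ = ∑ i e_i ⊗ (λ e_i)`,
`‖(A ⊗ I − I ⊗ B)ψ‖ = ‖λ Ā − B λ‖_F`; consequently if `‖(A ⊗ I − I ⊗ B)ψ‖ ≤ ε`
then `ρ = λ λᴴ` satisfies `‖ρ B − B ρ‖_F ≤ 2ε`. -/
theorem tensor_commute_lemma {d₁ d₂ : ℕ}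
    (A : Matrix (Fin d₁) (Fin d₁) ℂ) (hA : A.IsHermitian)
    (B : Matrix (Fin d₂) (Fin d₂) ℂ) (hB : B.IsHermitian)
    (lam : Matrix (Fin d₂) (Fin d₁) ℂ) (hlam : frobNorm lam = 1)
    (ψ : Fin d₁ × Fin d₂ → ℂ) (hψ : ψ = fun p => lam p.2 p.1) :
    cnorm ((A ⊗ₖ (1 : Matrix (Fin d₂) (Fin d₂) ℂ)
        - (1 : Matrix (Fin d₁) (Fin d₁) ℂ) ⊗ₖ B).mulVec ψ)
      = frobNorm (lam * A.map (starRingEnd ℂ) - B * lam) ∧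
    ∀ ε : ℝ,
      cnorm ((A ⊗ₖ (1 : Matrix (Fin d₂) (Fin d₂) ℂ)
          - (1 : Matrix (Fin d₁) (Fin d₁) ℂ) ⊗ₖ B).mulVec ψ) ≤ ε →
      frobNorm (lam * lamᴴ * B - B * (lam * lamᴴ)) ≤ 2 * ε := by
  have key : cnorm ((A ⊗ₖ (1 : Matrix (Fin d₂) (Fin d₂) ℂ)
        - (1 : Matrix (Fin d₁) (Fin d₁) ℂ) ⊗ₖ B).mulVec ψ)
      = frobNorm (lam * A.map (starRingEnd ℂ) - B * lam) := by
    rw [← cnorm_vec, ← kronecker_sub_mulVec_vec hA, hψ]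
    rfl
  refine ⟨key, fun ε hε => ?_⟩
  have hA' : (A.map (starRingEnd ℂ)).IsHermitian := hA.map_conj ▸ hA.transpose
  have h := frobNorm_commutator_le hA' hB lam
  rw [hlam, ← key] at h
  linarith
end
end

section
/- Let A_1,…,A_m be self-adjoint d₁×d₁ complex matrices, B_1,…,B_n self-adjoint d₂×d₂ complex matrices, λ a d₂×d₁ complex matrix with ‖λ‖_F = 1, and ψ = ∑_{i=1}^{d₁} e_i ⊗ (λ e_i) ∈ ℂ^{d₁} ⊗ ℂ^{d₂}. Let 𝓑₁ ⊆ M_{d₁}(ℂ) be the subalgebra generated by A_1,…,A_m and I, let 𝓑₂ ⊆ M_{d₂}(ℂ) be the subalgebra generated by B_1,…,B_n and I, and let 𝓑̄₁ = {M̄ : M ∈ 𝓑₁} (entrywise complex conjugates). Then the following are equivalent: (i) there is no orthogonal projection P ≠ I on ℂ^{d₁} commuting with every A_i such that (P ⊗ I)ψ = ψ, and no orthogonal projection Q ≠ I on ℂ^{d₂} commuting with every B_j such that (I ⊗ Q)ψ = ψ; (ii) 𝓑₂ · (range λ) spans ℂ^{d₂} and 𝓑̄₁ · (range λᴴ) spans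 ℂ^{d₁}. -/
open scoped BigOperators RealInnerProductSpace
open Matrix Kronecker

noncomputable section

/-- Every subspace of `ℂ^d` is the fixed space of a Hermitian idempotent matrix. -/
theorem exists_isHermitian_idempotent_fixing {d : Type*} [Fintype d] [DecidableEq d]
    (W : Submodule ℂ (d → ℂ)) :
    ∃ Q : Matrix d d ℂ, Q.IsHermitian ∧ Q * Q = Q ∧ (∀ x, Q *ᵥ x ∈ W) ∧
      ∀ x, Q *ᵥ x = x ↔ x ∈ W := by
  let U : Submodule ℂ (EuclideanSpace ℂ d) :=
    W.comap (WithLp.linearEquiv 2 ℂ (d → ℂ)).toLinearMap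
  obtain ⟨Q, hQ⟩ := EquivLike.surjective (Matrix.toEuclideanCLM (n := d) (𝕜 := ℂ)) U.starProjection
  have hQx (x : d → ℂ) : Q *ᵥ x = (U.starProjection (WithLp.toLp 2 x)).ofLp := by
    rw [← hQ, Matrix.ofLp_toEuclideanCLM]
  refine ⟨Q, ?_, ?_, fun x => ?_, fun x => ?_⟩
  · apply EquivLike.injective (Matrix.toEuclideanCLM (n := d) (𝕜 := ℂ))
    rw [← Matrix.star_eq_conjTranspose, map_star, hQ]
    exact isSelfAdjoint_starProjection U
  · apply EquivLike.injective (Matrix.toEuclideanCLM (n := d) (𝕜 := ℂ))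
    rw [map_mul, hQ]
    exact U.isIdempotentElem_starProjection
  · rw [hQx]
    exact U.starProjection_apply_mem _
  · rw [hQx]
    refine Iff.trans ?_ (U.starProjection_eq_self_iff (v := WithLp.toLp 2 x))
    exact ⟨fun h => WithLp.ofLp_injective 2 h, fun h => congrArg WithLp.ofLp h⟩

/-- For a family of Hermitian matrices `C`, the orbit of the range of `L` under the algebra
generated by `C` spans the whole space iff no nontrivial orthogonal projection commuting with `C`
fixes the range of `L`. -/
theorem not_exists_projection_iff_span_adjoin_eq_top {ι d e : Type*} [Fintype d] [DecidableEq d]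
    [Fintype e] [DecidableEq e] (C : ι → Matrix d d ℂ) (hC : ∀ i, (C i).IsHermitian)
    (L : Matrix d e ℂ) :
    (¬ ∃ Q : Matrix d d ℂ, Q ≠ 1 ∧ Q.IsHermitian ∧ Q * Q = Q ∧
        (∀ i, Q * C i = C i * Q) ∧ Q * L = L) ↔
      Submodule.span ℂ {x : d → ℂ | ∃ M ∈ Algebra.adjoin ℂ (Set.range C), ∃ y : e → ℂ,
        x = M *ᵥ (L *ᵥ y)} = ⊤ := by
  set W := Submodule.span ℂ {x : d → ℂ | ∃ M ∈ Algebra.adjoin ℂ (Set.range C), ∃ y : e → ℂ,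
    x = M *ᵥ (L *ᵥ y)} with hW
  constructor
  · intro h
    obtain ⟨Q, hQ, hQQ, hQmem, hQfix⟩ := exists_isHermitian_idempotent_fixing W
    have hinv (i : ι) : W ≤ W.comap (C i).mulVecLin := by
      rw [hW, Submodule.span_le]
      rintro _ ⟨M, hM, y, rfl⟩
      refine Submodule.subset_span ⟨C i * M, ?_, y, ?_⟩
      · exact mul_mem (Algebra.subset_adjoin ⟨i, rfl⟩) hM
      · simp [Matrix.mulVec_mulVec, Matrix.mul_assoc]
    have hcomp (i : ι) : Q * (C i * Q) = C i * Q := by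
      refine Matrix.ext_of_mulVec_single fun j => ?_
      rw [← Matrix.mulVec_mulVec, hQfix, ← Matrix.mulVec_mulVec]
      exact hinv i (hQmem _)
    have hcomm (i : ι) : Q * C i = C i * Q := by
      have := congrArg Matrix.conjTranspose (hcomp i)
      simp only [Matrix.conjTranspose_mul, hQ.eq, (hC i).eq] at this
      rw [← this, Matrix.mul_assoc, hcomp]
    have hL : Q * L = L := by
      refine Matrix.ext_of_mulVec_single fun j => ?_
      rw [← Matrix.mulVec_mulVec, hQfix]
      exact Submodule.subset_span ⟨1, one_mem _, _, by rw [Matrix.one_mulVec]⟩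
    have hQ1 : Q = 1 := by
      by_contra hne
      exact h ⟨Q, hne, hQ, hQQ, hcomm, hL⟩
    refine (Submodule.eq_top_iff').2 fun x => (hQfix x).1 ?_
    rw [hQ1, Matrix.one_mulVec]
  · rintro htop ⟨Q, hne, -, -, hcomm, hL⟩
    refine hne (Matrix.ext_of_mulVec_single fun j => ?_)
    have hle : W ≤ LinearMap.eqLocus Q.mulVecLin LinearMap.id := by
      rw [hW, Submodule.span_le]
      rintro _ ⟨M, hM, y, rfl⟩
      have hQM : Q * M = M * Q := by
        refine Algebra.adjoin_le (S := Subalgebra.centralizer ℂ {Q}) ?_ hM Q rfl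
        rintro _ ⟨i, rfl⟩ _ rfl
        exact hcomm i
      change Q *ᵥ (M *ᵥ (L *ᵥ y)) = M *ᵥ (L *ᵥ y)
      rw [Matrix.mulVec_mulVec, hQM, ← Matrix.mulVec_mulVec, Matrix.mulVec_mulVec y Q, hL]
    rw [Matrix.one_mulVec]
    exact hle (htop ▸ Submodule.mem_top)

/-- Entrywise conjugation of complex matrices is involutive. -/
theorem map_conj_map_conj {m n : Type*} (M : Matrix m n ℂ) :
    (M.map (starRingEnd ℂ)).map (starRingEnd ℂ) = M := by
  ext i j
  simp

theorem map_conj_mem_adjoin {ι d : Type*} [Fintype d] [DecidableEq d] {C : ι → Matrix d d ℂ}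
    {M : Matrix d d ℂ} (hM : M ∈ Algebra.adjoin ℂ (Set.range C)) :
    M.map (starRingEnd ℂ) ∈
      Algebra.adjoin ℂ (Set.range fun i => (C i).map (starRingEnd ℂ)) := by
  induction hM using Algebra.adjoin_induction with
  | mem x hx =>
    obtain ⟨i, rfl⟩ := hx
    exact Algebra.subset_adjoin ⟨i, rfl⟩
  | algebraMap r =>
    convert Subalgebra.algebraMap_mem _ (starRingEnd ℂ r) using 1
    ext i j
    by_cases h : i = j <;> simp [Matrix.algebraMap_matrix_apply, h]
  | add x y _ _ hx hy =>
    rw [Matrix.map_add _ (map_add _)]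
    exact add_mem hx hy
  | mul x y _ _ hx hy =>
    rw [Matrix.map_mul]
    exact mul_mem hx hy

/-- characterization of nondegeneracy: a quantum strategy
`{A_i},{B_j},ψ` with `ψ = ∑ i e_i ⊗ (λ e_i)` is nondegenerate iff
`𝓑₂ ⋅ (range λ)` spans `ℂ^{d₂}` and `𝓑̄₁ ⋅ (range λᴴ)` spans `ℂ^{d₁}`. -/
theorem nondegenerate_iff_spans {m n d₁ d₂ : ℕ}
    (A : Fin m → Matrix (Fin d₁) (Fin d₁) ℂ) (hA : ∀ i, (A i).IsHermitian)
    (B : Fin n → Matrix (Fin d₂) (Fin d₂) ℂ) (hB : ∀ j, (B j).IsHermitian)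
    (lam : Matrix (Fin d₂) (Fin d₁) ℂ) (hlam : frobNorm lam = 1)
    (ψ : Fin d₁ × Fin d₂ → ℂ) (hψ : ψ = fun p => lam p.2 p.1) :
    Nondegenerate A B ψ ↔
      (Submodule.span ℂ {x : Fin d₂ → ℂ |
          ∃ M ∈ Algebra.adjoin ℂ (Set.range B), ∃ y : Fin d₁ → ℂ,
            x = M.mulVec (lam.mulVec y)} = ⊤ ∧
       Submodule.span ℂ {x : Fin d₁ → ℂ |
          ∃ M ∈ Algebra.adjoin ℂ (Set.range A), ∃ y : Fin d₂ → ℂ,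
            x = (M.map (starRingEnd ℂ)).mulVec (lamᴴ.mulVec y)} = ⊤) := by
  have hconj {k l : ℕ} (X Y : Matrix (Fin k) (Fin l) ℂ) :
      X.map (starRingEnd ℂ) = Y.map (starRingEnd ℂ) ↔ X = Y :=
    ⟨fun h => by rw [← map_conj_map_conj X, h, map_conj_map_conj], fun h => by rw [h]⟩
  have hvec : ψ = Matrix.vec lam := hψ
  have hset : {x : Fin d₁ → ℂ | ∃ M ∈ Algebra.adjoin ℂ (Set.range A), ∃ y : Fin d₂ → ℂ,
        x = (M.map (starRingEnd ℂ)).mulVec (lamᴴ.mulVec y)} =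
      {x | ∃ M ∈ Algebra.adjoin ℂ (Set.range fun i => (A i).map (starRingEnd ℂ)),
        ∃ y : Fin d₂ → ℂ, x = M *ᵥ (lamᴴ *ᵥ y)} := by
    ext x
    constructor
    · rintro ⟨M, hM, y, rfl⟩
      exact ⟨_, map_conj_mem_adjoin hM, y, rfl⟩
    · rintro ⟨M, hM, y, rfl⟩
      refine ⟨M.map (starRingEnd ℂ), ?_, y, by rw [map_conj_map_conj]⟩
      simpa only [map_conj_map_conj] using map_conj_mem_adjoin hM
  have hHerm {M : Matrix (Fin d₁) (Fin d₁) ℂ} (hM : M.IsHermitian) :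
      (M.map (starRingEnd ℂ)).IsHermitian := hM.map _ fun _ => rfl
  have hfix (P : Matrix (Fin d₁) (Fin d₁) ℂ) :
      (P ⊗ₖ (1 : Matrix (Fin d₂) (Fin d₂) ℂ)) *ᵥ ψ = ψ ↔
        P.map (starRingEnd ℂ) * lamᴴ = lamᴴ := by
    rw [hvec, Matrix.kronecker_mulVec_vec, Matrix.vec_inj, Matrix.one_mul,
      ← Matrix.conjTranspose_inj, Matrix.conjTranspose_mul]
    rfl
  rw [hset, ← not_exists_projection_iff_span_adjoin_eq_top B hB lam,
    ← not_exists_projection_iff_span_adjoin_eq_top _ (fun i => hHerm (hA i)) lamᴴ, and_comm]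
  refine and_congr (not_congr ⟨?_, ?_⟩) (not_congr (exists_congr fun Q => ?_))
  · rintro ⟨P, hne, hP, hPP, hcomm, hPψ⟩
    refine ⟨P.map (starRingEnd ℂ), fun h => hne ?_, hHerm hP, ?_, fun i => ?_, (hfix P).1 hPψ⟩
    · rw [← hconj, h, Matrix.map_one _ (map_zero _) (map_one _)]
    · rw [← Matrix.map_mul, hPP]
    · rw [← Matrix.map_mul, hcomm, Matrix.map_mul]
  · rintro ⟨P, hne, hP, hPP, hcomm, hPL⟩
    refine ⟨P.map (starRingEnd ℂ), fun h => hne ?_, hHerm hP, ?_, fun i => ?_, (hfix _).2 ?_⟩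
    · rw [← hconj, h, Matrix.map_one _ (map_zero _) (map_one _)]
    · rw [← Matrix.map_mul, hPP]
    · rw [← hconj, Matrix.map_mul, Matrix.map_mul, map_conj_map_conj, hcomm]
    · rwa [map_conj_map_conj]
  · rw [hvec, Matrix.kronecker_mulVec_vec, Matrix.vec_inj, Matrix.transpose_one, Matrix.mul_one]
end
end

section
/- Let ρ be a density matrix on ℂ^d with τ := ‖ρ − I/d‖ > 0 (operator norm). Then there is an orthogonal decomposition ℂ^d = W₁ ⊕ W₂ into nonzero subspaces such that: (a) W₁ and W₂ are invariant under ρ; (b) whenever α₁ is an eigenvalue of ρ with eigenvector in W₁ and α₂ is an eigenvalue of ρ with eigenvector in W₂, then α₁ ≥ α₂ + τ/d; and (c) for every d×d complex matrix S and ε ≥ 0 with ‖ρS − Sρ‖_F ≤ ε, one has ‖P₁ S P₁ + P₂ S P₂ − S‖_F ≤ εd/τ, where P_i is the orthogonal projection onto W_i. -/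
open scoped BigOperators RealInnerProductSpace ComplexOrder
open Matrix Kronecker

noncomputable section

/-- If the range of a finite real family has length at least `g` times its cardinality, the family
splits into two nonempty parts separated by a gap of length `g`. -/
theorem exists_finset_gap {ι : Type*} [Fintype ι] [DecidableEq ι] (f : ι → ℝ) (p q : ι) {g : ℝ}
    (hg : 0 < g) (h : Fintype.card ι * g ≤ f p - f q) :
    ∃ L : Finset ι, L.Nonempty ∧ Lᶜ.Nonempty ∧ ∀ i ∈ L, ∀ j ∈ Lᶜ, f i + g ≤ f j := by
  by_contra! H
  have key : ∀ k : ℕ, k < Fintype.card ι →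
      k + 1 ≤ (Finset.univ.filter fun i => f i ≤ f q + k * g).card := by
    intro k
    induction k with
    | zero =>
      intro _
      exact Finset.card_pos.mpr ⟨q, by simp⟩
    | succ k ih =>
      intro hk
      have hsub : (Finset.univ.filter fun i => f i ≤ f q + k * g) ⊆
          Finset.univ.filter fun i => f i ≤ f q + (k + 1 : ℕ) * g := by
        intro i hi
        simp only [Finset.mem_filter, Finset.mem_univ, true_and] at hi ⊢
        push_cast
        linarith
      have hk' := ih (by omega)
      by_cases hu : (Finset.univ.filter fun i => f i ≤ f q + k * g)ᶜ.Nonempty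
      · obtain ⟨i, hi, j, hj, hij⟩ := H _ (Finset.card_pos.mp (by omega)) hu
        refine hk'.trans_lt (Finset.card_lt_card ((Finset.ssubset_iff_of_subset hsub).mpr
          ⟨j, ?_, Finset.mem_compl.mp hj⟩))
        simp only [Finset.mem_filter, Finset.mem_univ, true_and] at hi ⊢
        push_cast
        linarith
      · rw [Finset.not_nonempty_iff_eq_empty, Finset.compl_eq_empty_iff] at hu
        rw [hu, Finset.univ_subset_iff] at hsub
        rw [hsub, Finset.card_univ]
        omega
  have hpos : 0 < Fintype.card ι := Fintype.card_pos_iff.mpr ⟨p⟩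
  have hcard := key (Fintype.card ι - 1) (by omega)
  rw [Nat.sub_add_cancel hpos] at hcard
  have huniv := (Finset.card_eq_iff_eq_univ _).mp (le_antisymm (Finset.card_le_univ _) hcard)
  have hp := huniv.ge (Finset.mem_univ p)
  simp only [Finset.mem_filter, Finset.mem_univ, true_and] at hp
  rw [Nat.cast_sub hpos, Nat.cast_one] at hp
  linarith

/-- A real family attaining a deviation `t` from its mean has two members at distance at
least `t`. -/
theorem exists_le_sub_of_abs_sub_mean {ι : Type*} [Fintype ι] (f : ι → ℝ) {m t : ℝ}
    (hsum : ∑ i, f i = ∑ _i : ι, m) (k : ι) (hk : t ≤ |f k - m|) :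
    ∃ p q, t ≤ f p - f q := by
  have hne : (Finset.univ : Finset ι).Nonempty := ⟨k, Finset.mem_univ k⟩
  obtain ⟨i, -, hi⟩ := Finset.exists_le_of_sum_le hne hsum.le
  obtain ⟨j, -, hj⟩ := Finset.exists_le_of_sum_le hne hsum.ge
  rcases le_abs.mp hk with h | h
  · exact ⟨k, i, by linarith⟩
  · exact ⟨j, k, by linarith⟩

open scoped Matrix.Norms.L2Operator in
/-- The operator norm of a unitarily diagonalized matrix shifted by a real scalar is attained at
some diagonal entry. -/
theorem exists_opNorm_sub_smul_one_eq {n : Type*} [Fintype n] [DecidableEq n] [Nonempty n]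
    (U : Matrix.unitaryGroup n ℂ) (f : n → ℝ) (m : ℝ) :
    ∃ k, opNorm ((U : Matrix n n ℂ) * diagonal (fun i => (f i : ℂ)) * star (U : Matrix n n ℂ)
      - (m : ℂ) • 1) = |f k - m| := by
  have hd : (U : Matrix n n ℂ) * diagonal (fun i => (f i : ℂ)) * star (U : Matrix n n ℂ)
      - (m : ℂ) • 1 = (U : Matrix n n ℂ) * diagonal (fun i => ((f i - m : ℝ) : ℂ)) *
        ((star U : Matrix.unitaryGroup n ℂ) : Matrix n n ℂ) := by
    have h1 : diagonal (fun i => ((f i - m : ℝ) : ℂ)) =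
        diagonal (fun i => (f i : ℂ)) - (m : ℂ) • (1 : Matrix n n ℂ) := by
      rw [smul_one_eq_diagonal, diagonal_sub]
      simp
    rw [h1, mul_sub, sub_mul, Matrix.mul_smul, mul_one, Matrix.smul_mul, Unitary.coe_star,
      Unitary.mul_star_self_of_mem U.2]
  obtain ⟨k, -, hk⟩ := Finset.exists_mem_eq_sup Finset.univ Finset.univ_nonempty
    (fun i => ‖((f i - m : ℝ) : ℂ)‖₊)
  refine ⟨k, ?_⟩
  rw [opNorm, l2_opNorm_toEuclideanCLM, hd, CStarRing.norm_mul_coe_unitary,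
    CStarRing.norm_coe_unitary_mul, l2_opNorm_diagonal, Pi.norm_def, hk, coe_nnnorm,
    Complex.norm_real, Real.norm_eq_abs]

theorem frobNorm_eq_sqrt_trace {n : Type*} [Fintype n] (M : Matrix n n ℂ) :
    frobNorm M = Real.sqrt (Mᴴ * M).trace.re := by
  rw [frobNorm, Finset.sum_comm]
  congr 1
  simp only [trace, diag_apply, mul_apply, conjTranspose_apply, Complex.re_sum]
  refine Finset.sum_congr rfl fun i _ => Finset.sum_congr rfl fun j _ => ?_
  simp [Complex.sq_norm, Complex.normSq_apply]

theorem frobNorm_unitary_conj {n : Type*} [Fintype n] [DecidableEq n]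
    (U : Matrix.unitaryGroup n ℂ) (M : Matrix n n ℂ) :
    frobNorm ((U : Matrix n n ℂ) * M * star (U : Matrix n n ℂ)) = frobNorm M := by
  rw [frobNorm_eq_sqrt_trace, frobNorm_eq_sqrt_trace]
  have h := Unitary.coe_star_mul_self U
  have e : ((U : Matrix n n ℂ) * M * star (U : Matrix n n ℂ))ᴴ *
      ((U : Matrix n n ℂ) * M * star (U : Matrix n n ℂ)) =
      (U : Matrix n n ℂ) * (Mᴴ * M * star (U : Matrix n n ℂ)) := by
    simp only [← star_eq_conjTranspose, star_mul, star_star]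
    calc _ = (U : Matrix n n ℂ) * (star M * (star (U : Matrix n n ℂ) * U) * M *
          star (U : Matrix n n ℂ)) := by simp only [mul_assoc]
      _ = _ := by rw [h, mul_one]
  rw [e, trace_mul_comm, mul_assoc, h, mul_one]

/-- The coordinate projection onto the span of the basis vectors indexed by `s`. -/
def coordProj {n : Type*} [DecidableEq n] (s : Finset n) : Matrix n n ℂ :=
  diagonal fun i => if i ∈ s then 1 else 0

theorem coordProj_mul_self {n : Type*} [Fintype n] [DecidableEq n] (s : Finset n) :
    coordProj s * coordProj s = coordProj s := by
  simp [coordProj]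

theorem coordProj_conjTranspose {n : Type*} [DecidableEq n] (s : Finset n) :
    (coordProj s)ᴴ = coordProj s := by
  rw [coordProj, diagonal_conjTranspose]
  congr 1
  ext i
  by_cases h : i ∈ s <;> simp [h]

theorem coordProj_compl_add {n : Type*} [Fintype n] [DecidableEq n] (s : Finset n) :
    coordProj sᶜ + coordProj s = 1 := by
  rw [coordProj, coordProj, diagonal_add, ← diagonal_one]
  congr 1
  ext i
  by_cases h : i ∈ s <;> simp [h]

theorem coordProj_compl_mul {n : Type*} [Fintype n] [DecidableEq n] (s : Finset n) :
    coordProj sᶜ * coordProj s = 0 := by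
  rw [coordProj, coordProj, diagonal_mul_diagonal, ← diagonal_zero]
  congr 1
  ext i
  by_cases h : i ∈ s <;> simp [h]

theorem coordProj_ne_zero {n : Type*} [DecidableEq n] {s : Finset n} (hs : s.Nonempty) :
    coordProj s ≠ 0 := by
  obtain ⟨i, hi⟩ := hs
  intro h
  have := congrFun (congrFun h i) i
  simp [coordProj, hi] at this

theorem diagonal_mul_coordProj {n : Type*} [Fintype n] [DecidableEq n] (v : n → ℂ)
    (s : Finset n) : diagonal v * coordProj s = coordProj s * diagonal v := by
  simp [coordProj, mul_comm]

/-- An eigenvector of a diagonal matrix supported on `s` has a diagonal entry indexed by `s` as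
its eigenvalue. -/
theorem exists_eigenvalue_eq_of_coordProj {n : Type*} [Fintype n] [DecidableEq n] {f : n → ℝ}
    {s : Finset n} {y : n → ℂ} (hy : y ≠ 0) {α : ℝ}
    (h : diagonal (fun i => (f i : ℂ)) *ᵥ y = (α : ℂ) • y) (hs : coordProj s *ᵥ y = y) :
    ∃ i ∈ s, f i = α := by
  obtain ⟨i, hi⟩ := Function.ne_iff.mp hy
  have h1 := congrFun h i
  have h2 := congrFun hs i
  rw [mulVec_diagonal, Pi.smul_apply, smul_eq_mul] at h1
  rw [coordProj, mulVec_diagonal] at h2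
  refine ⟨i, ?_, Complex.ofReal_injective (mul_right_cancel₀ hi h1)⟩
  by_contra hn
  rw [if_neg hn, zero_mul] at h2
  exact hi h2.symm

/-- Block-diagonal compression along a spectral gap `g` is controlled by the commutator. -/
theorem mul_frobNorm_compress_sub_le {n : Type*} [Fintype n] [DecidableEq n] {f : n → ℝ}
    {L : Finset n} {g : ℝ} (hg : 0 ≤ g) (hL : ∀ i ∈ L, ∀ j ∈ Lᶜ, f i + g ≤ f j)
    (S : Matrix n n ℂ) :
    g * frobNorm (coordProj Lᶜ * S * coordProj Lᶜ + coordProj L * S * coordProj L - S) ≤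
      frobNorm (diagonal (fun i => (f i : ℂ)) * S - S * diagonal (fun i => (f i : ℂ))) := by
  rw [frobNorm, frobNorm]
  refine Real.le_sqrt_of_sq_le ?_
  rw [mul_pow, Real.sq_sqrt (by positivity), Finset.mul_sum]
  refine Finset.sum_le_sum fun i _ => ?_
  rw [Finset.mul_sum]
  refine Finset.sum_le_sum fun j _ => ?_
  have hc : (diagonal (fun i => (f i : ℂ)) * S - S * diagonal (fun i => (f i : ℂ))) i j =
      ((f i - f j : ℝ) : ℂ) * S i j := by
    simp only [Matrix.sub_apply, diagonal_mul, mul_diagonal]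
    push_cast
    ring
  rw [hc, norm_mul, mul_pow, Complex.norm_real, Real.norm_eq_abs, sq_abs]
  simp only [coordProj, Matrix.sub_apply, Matrix.add_apply, diagonal_mul, mul_diagonal, Finset.mem_compl]
  by_cases hi : i ∈ L <;> by_cases hj : j ∈ L
  · simp only [hi, hj]
    simp
    positivity
  · have := hL i hi j (Finset.mem_compl.mpr hj)
    simp only [hi, hj]
    simp
    refine mul_le_mul_of_nonneg_right ?_ (by positivity)
    nlinarith
  · have := hL j hj i (Finset.mem_compl.mpr hi)
    simp only [hi, hj]
    simp
    refine mul_le_mul_of_nonneg_right ?_ (by positivity)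
    nlinarith
  · simp only [hi, hj]
    simp
    positivity

/-- Babai–Friedl eigenvalue gap lemma: if a density matrix `ρ`
on `ℂ^d` has `τ = ‖ρ − I/d‖ > 0`, there is an orthogonal decomposition
`ℂ^d = W₁ ⊕ W₂` (given by the orthogonal projections `P₁, P₂`) into nonzero
`ρ`-invariant subspaces with an eigenvalue gap `τ/d`, such that any `S`
approximately commuting with `ρ` is close to `P₁ S P₁ + P₂ S P₂`. -/
theorem eigenvalue_gap_decomposition {d : ℕ}
    (ρ : Matrix (Fin d) (Fin d) ℂ) (hρ : ρ.PosSemidef) (htr : ρ.trace = 1)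
    (τ : ℝ) (hτdef : τ = opNorm (ρ - ((d : ℂ))⁻¹ • 1)) (hτ : 0 < τ) :
    ∃ P₁ P₂ : Matrix (Fin d) (Fin d) ℂ,
      P₁.IsHermitian ∧ P₂.IsHermitian ∧ P₁ * P₁ = P₁ ∧ P₂ * P₂ = P₂ ∧
      P₁ + P₂ = 1 ∧ P₁ * P₂ = 0 ∧ P₁ ≠ 0 ∧ P₂ ≠ 0 ∧
      ρ * P₁ = P₁ * ρ ∧ ρ * P₂ = P₂ * ρ ∧
      (∀ (α₁ α₂ : ℝ) (x₁ x₂ : Fin d → ℂ), x₁ ≠ 0 → x₂ ≠ 0 →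
        ρ.mulVec x₁ = (α₁ : ℂ) • x₁ → P₁.mulVec x₁ = x₁ →
        ρ.mulVec x₂ = (α₂ : ℂ) • x₂ → P₂.mulVec x₂ = x₂ →
        α₂ + τ / d ≤ α₁) ∧
      (∀ (S : Matrix (Fin d) (Fin d) ℂ) (ε : ℝ), 0 ≤ ε →
        frobNorm (ρ * S - S * ρ) ≤ ε →
        frobNorm (P₁ * S * P₁ + P₂ * S * P₂ - S) ≤ ε * d / τ) := by
  have hd : 0 < d := by
    rcases Nat.eq_zero_or_pos d with rfl | h
    · simp [trace] at htr
    · exact h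
  have hd' : (0 : ℝ) < d := Nat.cast_pos.mpr hd
  have : Nonempty (Fin d) := ⟨⟨0, hd⟩⟩
  set f := hρ.isHermitian.eigenvalues
  set U := hρ.isHermitian.eigenvectorUnitary
  have hspec : ρ = (U : Matrix (Fin d) (Fin d) ℂ) * diagonal (fun i => (f i : ℂ)) *
      star (U : Matrix (Fin d) (Fin d) ℂ) := hρ.isHermitian.spectral_theorem
  have hsum : ∑ i, f i = ∑ _i : Fin d, (d : ℝ)⁻¹ := by
    have h := hρ.isHermitian.trace_eq_sum_eigenvalues
    rw [htr] at h
    have h' : ∑ i, f i = 1 := by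
      apply Complex.ofReal_injective
      rw [Complex.ofReal_sum, Complex.ofReal_one]
      exact h.symm
    rw [h']
    simp [hd'.ne']
  obtain ⟨k, hk⟩ := exists_opNorm_sub_smul_one_eq U f (d : ℝ)⁻¹
  rw [← hspec, Complex.ofReal_inv, Complex.ofReal_natCast, ← hτdef] at hk
  obtain ⟨p, q, hpq⟩ := exists_le_sub_of_abs_sub_mean f hsum k hk.le
  have hg : 0 < τ / d := div_pos hτ hd'
  obtain ⟨L, hL, hLc, hgap⟩ := exists_finset_gap f p q hg (by
    rw [Fintype.card_fin, mul_div_cancel₀ _ hd'.ne']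
    exact hpq)
  set D : Matrix (Fin d) (Fin d) ℂ := diagonal (fun i => (f i : ℂ)) with hD
  let φ := Unitary.conjStarAlgAut ℂ (Matrix (Fin d) (Fin d) ℂ) U
  have hφ : ∀ M, φ M = (U : Matrix (Fin d) (Fin d) ℂ) * M *
      star (U : Matrix (Fin d) (Fin d) ℂ) := fun M => Unitary.conjStarAlgAut_apply _ _
  have hρφ : ρ = φ D := by rw [hφ]; exact hspec
  have hherm : ∀ s, (φ (coordProj s)).IsHermitian := fun s => by
    rw [IsHermitian, ← star_eq_conjTranspose, ← map_star, star_eq_conjTranspose,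
      coordProj_conjTranspose]
  have hcomm : ∀ s, ρ * φ (coordProj s) = φ (coordProj s) * ρ := fun s => by
    rw [hρφ, ← map_mul, ← map_mul, hD, diagonal_mul_coordProj]
  have hne : ∀ s : Finset (Fin d), s.Nonempty → φ (coordProj s) ≠ 0 := fun s hs h =>
    coordProj_ne_zero hs ((map_eq_zero_iff φ φ.injective).mp h)
  have hVU : star (U : Matrix (Fin d) (Fin d) ℂ) * (U : Matrix (Fin d) (Fin d) ℂ) = 1 :=
    Unitary.coe_star_mul_self U
  have hUV : (U : Matrix (Fin d) (Fin d) ℂ) * star (U : Matrix (Fin d) (Fin d) ℂ) = 1 :=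
    Unitary.coe_mul_star_self U
  have hVφ : ∀ M (x : Fin d → ℂ), star (U : Matrix (Fin d) (Fin d) ℂ) *ᵥ (φ M *ᵥ x) =
      M *ᵥ (star (U : Matrix (Fin d) (Fin d) ℂ) *ᵥ x) := fun M x => by
    rw [hφ, mulVec_mulVec, mulVec_mulVec, ← mul_assoc, ← mul_assoc, hVU, one_mul]
  have heig : ∀ (s : Finset (Fin d)) (α : ℝ) (x : Fin d → ℂ), x ≠ 0 →
      ρ *ᵥ x = (α : ℂ) • x → φ (coordProj s) *ᵥ x = x → ∃ i ∈ s, f i = α := by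
    intro s α x hx h1 h2
    refine exists_eigenvalue_eq_of_coordProj
      (y := star (U : Matrix (Fin d) (Fin d) ℂ) *ᵥ x) ?_ ?_ ?_
    · intro h0
      apply hx
      rw [← one_mulVec x, ← hUV, ← mulVec_mulVec, h0, mulVec_zero]
    · rw [← hD, ← hVφ, ← hρφ, h1, mulVec_smul]
    · rw [← hVφ, h2]
  refine ⟨φ (coordProj Lᶜ), φ (coordProj L), hherm _, hherm _, ?_, ?_, ?_, ?_, hne _ hLc,
    hne _ hL, hcomm _, hcomm _, ?_, ?_⟩
  · rw [← map_mul, coordProj_mul_self]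
  · rw [← map_mul, coordProj_mul_self]
  · rw [← map_add, coordProj_compl_add, map_one]
  · rw [← map_mul, coordProj_compl_mul, map_zero]
  · intro α₁ α₂ x₁ x₂ hx₁ hx₂ h₁ hP₁ h₂ hP₂
    obtain ⟨j, hj, rfl⟩ := heig _ α₁ x₁ hx₁ h₁ hP₁
    obtain ⟨i, hi, rfl⟩ := heig _ α₂ x₂ hx₂ h₂ hP₂
    exact hgap i hi j hj
  · intro S ε _ hS
    obtain ⟨T, rfl⟩ : ∃ T, φ T = S := EquivLike.surjective φ S
    have hnorm : ∀ M, frobNorm (φ M) = frobNorm M := fun M => by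
      rw [hφ, frobNorm_unitary_conj]
    rw [hρφ, ← map_mul, ← map_mul, ← map_sub, hnorm] at hS
    simp only [← map_mul, ← map_add, ← map_sub, hnorm]
    have h := (mul_frobNorm_compress_sub_le hg.le hgap T).trans hS
    rw [le_div_iff₀ hτ]
    rw [div_mul_eq_mul_div, div_le_iff₀ hd'] at h
    linarith
end
end

section
/- Let n ≥ 1 and let 0 < ε < 1/(250 n²). Suppose B_1,…,B_n are self-adjoint d×d complex matrices such that ‖B_i‖ ≤ 1 for all i, ‖B_i² − I‖ ≤ ε for all i, and ‖B_i B_j + B_j B_i‖ ≤ ε for all i ≠ j (operator norm). Then there exist self-adjoint d×d complex matrices B_1',…,B_n' with B_i'² = I for all i and B_i' B_j' = −B_j' B_i' for all i ≠ j, such that ‖B_i − B_i'‖ ≤ 5 n² ε / 2 for every i. -/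
open scoped BigOperators RealInnerProductSpace
open Matrix Kronecker

noncomputable section

/-- A self-adjoint element whose square is close to `1` is close to a self-adjoint involution that
anticommutes with everything the given element anticommutes with. -/
theorem exists_isSelfAdjoint_involution_near {A : Type*} [CStarAlgebra A] {b : A} {η : ℝ}
    (hb : IsSelfAdjoint b) (hη : η < 1) (h : ‖b ^ 2 - 1‖ ≤ η) :
    ∃ x : A, IsSelfAdjoint x ∧ x * x = 1 ∧ ‖b - x‖ ≤ η ∧
      ∀ y : A, y * b + b * y = 0 → y * x + x * y = 0 := by
  have hη0 : 0 ≤ η := (norm_nonneg _).trans h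
  have hspec : ∀ t ∈ spectrum ℝ b, |t ^ 2 - 1| ≤ η := by
    intro t ht
    have h1 : cfc (fun t : ℝ => t ^ 2 - 1) b = b ^ 2 - 1 := by
      rw [cfc_sub (fun t : ℝ => t ^ 2) (fun _ => 1) b, cfc_pow_id (R := ℝ) b 2, cfc_const_one ℝ b]
    have h2 := norm_apply_le_norm_cfc (fun t : ℝ => t ^ 2 - 1) b ht
    rw [h1] at h2
    exact h2.trans h
  have hpos : ∀ t ∈ spectrum ℝ b, 0 < |t| := by
    intro t ht
    rw [abs_pos]
    rintro rfl
    have := hspec 0 ht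
    norm_num at this
    linarith
  have hg : ContinuousOn (fun y : ℝ => (√y)⁻¹) ((· ^ 2) '' spectrum ℝ b) := by
    refine ContinuousOn.inv₀ (by fun_prop) ?_
    rintro _ ⟨t, ht, rfl⟩
    simpa [Real.sqrt_sq_eq_abs] using hpos t ht
  have hf : ContinuousOn (fun t : ℝ => (√(t ^ 2))⁻¹) (spectrum ℝ b) := by
    refine ContinuousOn.inv₀ (by fun_prop) ?_
    intro t ht
    simpa [Real.sqrt_sq_eq_abs] using hpos t ht
  set s : ℝ → ℝ := fun t => t * (√(t ^ 2))⁻¹ with hs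
  have hsc : ContinuousOn s (spectrum ℝ b) := continuousOn_id.mul hf
  have hx : cfc s b = b * cfc (fun y : ℝ => (√y)⁻¹) (b ^ 2) := by
    rw [hs, cfc_mul (fun t : ℝ => t) (fun t => (√(t ^ 2))⁻¹) b (by fun_prop) hf,
      cfc_id' ℝ b, cfc_comp_pow (fun y : ℝ => (√y)⁻¹) 2 b hg]
  refine ⟨cfc s b, cfc_predicate s b, ?_, ?_, ?_⟩
  · rw [← cfc_mul s s b hsc hsc, ← cfc_const_one ℝ b]
    refine cfc_congr fun t ht => ?_
    have := (hpos t ht).ne'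
    simp only [hs, Real.sqrt_sq_eq_abs]
    field_simp
    exact (sq_abs t).symm
  · have h1 : cfc (fun t : ℝ => t - s t) b = b - cfc s b := by
      rw [cfc_sub (fun t : ℝ => t) s b (by fun_prop) hsc, cfc_id' ℝ b]
    rw [← h1]
    refine norm_cfc_le hη0 fun t ht => le_trans ?_ (hspec t ht)
    have ht0 := hpos t ht
    have h2 : t ^ 2 - 1 = (t - s t) * (t + s t) := by
      have : s t * s t = 1 := by
        simp only [hs, Real.sqrt_sq_eq_abs]
        field_simp
        exact (sq_abs t).symm
      linear_combination this
    have h3 : 1 ≤ |t + s t| := by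
      simp only [hs, Real.sqrt_sq_eq_abs]
      have h4 : t + t * |t|⁻¹ = t * (1 + |t|⁻¹) := by ring
      rw [h4, abs_mul, abs_of_pos (by positivity : 0 < 1 + |t|⁻¹)]
      rw [mul_add, mul_inv_cancel₀ ht0.ne']
      linarith
    rw [h2, abs_mul, Real.norm_eq_abs]
    exact le_mul_of_one_le_right (abs_nonneg _) h3
  · intro y hy
    have hyb : y * b = -(b * y) := eq_neg_of_add_eq_zero_left hy
    have hcomm : Commute (b ^ 2) y := by
      rw [commute_iff_eq, pow_two, mul_assoc, ← mul_assoc y, hyb, neg_mul, mul_assoc b y b, hyb]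
      simp
    have := (hcomm.cfc_real fun y : ℝ => (√y)⁻¹).eq
    rw [hx, mul_assoc, this, ← mul_assoc, hyb, neg_mul, mul_assoc, neg_add_cancel]

/-- The part of `b` that anticommutes with an involution `x`. -/
def oddPart {A : Type*} [CStarAlgebra A] (x b : A) : A := (1 / 2 : ℝ) • (b - x * b * x)

/-- The part of `b` that commutes with an involution `x`. -/
def evenPart {A : Type*} [CStarAlgebra A] (x b : A) : A := (1 / 2 : ℝ) • (b + x * b * x)

section Parts

variable {A : Type*} [CStarAlgebra A] {x : A}

theorem sub_oddPart (b : A) : b - oddPart x b = evenPart x b := by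
  unfold oddPart evenPart
  module

theorem isSelfAdjoint_oddPart (hx : IsSelfAdjoint x) {b : A} (hb : IsSelfAdjoint b) :
    IsSelfAdjoint (oddPart x b) := by
  simp [IsSelfAdjoint, oddPart, hx.star_eq, hb.star_eq, mul_assoc]

theorem oddPart_mul_add_evenPart_mul (hxx : x * x = 1) (b c : A) :
    oddPart x b * oddPart x c + evenPart x b * evenPart x c = evenPart x (b * c) := by
  have h : x * b * x * (x * c * x) = x * (b * c) * x := by
    calc x * b * x * (x * c * x) = x * b * (x * x) * (c * x) := by noncomm_ring
      _ = x * (b * c) * x := by rw [hxx]; noncomm_ring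
  simp only [oddPart, evenPart, smul_mul_smul_comm, mul_add, add_mul, mul_sub, sub_mul, h]
  module

theorem evenPart_add (b c : A) : evenPart x (b + c) = evenPart x b + evenPart x c := by
  simp only [evenPart, mul_add, add_mul]
  module

theorem evenPart_one (hxx : x * x = 1) : evenPart x 1 = 1 := by
  simp only [evenPart, mul_one, hxx]
  module

theorem evenPart_sub (b c : A) : evenPart x (b - c) = evenPart x b - evenPart x c := by
  simp only [evenPart, mul_sub, sub_mul]
  module

theorem anticommute_oddPart (hxx : x * x = 1) (b : A) :
    x * oddPart x b + oddPart x b * x = 0 := by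
  have h1 : x * (x * b * x) = b * x := by rw [← mul_assoc, ← mul_assoc, hxx, one_mul]
  have h2 : x * b * x * x = x * b := by rw [mul_assoc, hxx, mul_one]
  simp only [oddPart, mul_smul_comm, smul_mul_assoc, mul_sub, sub_mul, h1, h2]
  module

theorem oddPart_eq_self (hxx : x * x = 1) {b : A} (h : x * b + b * x = 0) : oddPart x b = b := by
  rw [oddPart, eq_neg_of_add_eq_zero_left h, neg_mul, mul_assoc, hxx, mul_one]
  module

/-- Taking odd parts preserves anticommutation with any element anticommuting with `x`. -/
theorem anticommute_oddPart_of_anticommute {y b : A} (hx : y * x + x * y = 0)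
    (hb : y * b + b * y = 0) : y * oddPart x b + oddPart x b * y = 0 := by
  have h : y * (x * b * x) + x * b * x * y = 0 := by
    have h1 : y * (x * b * x) + x * b * x * y
      = (y * x + x * y) * b * x - x * (y * b + b * y) * x + x * b * (y * x + x * y) := by
      noncomm_ring
    rw [h1, hx, hb]
    simp
  have h2 : y * oddPart x b + oddPart x b * y
      = (1 / 2 : ℝ) • ((y * b + b * y) - (y * (x * b * x) + x * b * x * y)) := by
    simp only [oddPart, mul_smul_comm, smul_mul_assoc, mul_sub, sub_mul]
    module
  rw [h2, h, hb]
  simp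

theorem norm_le_one_of_involution (hx : IsSelfAdjoint x) (hxx : x * x = 1) : ‖x‖ ≤ 1 := by
  rcases subsingleton_or_nontrivial A with _ | _
  · simp [Subsingleton.elim x 0]
  · have h := CStarRing.norm_star_mul_self (x := x)
    rw [hx.star_eq, hxx, CStarRing.norm_one] at h
    nlinarith [norm_nonneg x]

theorem norm_conj_le (hn : ‖x‖ ≤ 1) (b : A) : ‖x * b * x‖ ≤ ‖b‖ :=
  calc ‖x * b * x‖ ≤ ‖x‖ * ‖b‖ * ‖x‖ := norm_mul₃_le
    _ ≤ 1 * ‖b‖ * 1 := by gcongr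
    _ = ‖b‖ := by ring

theorem norm_oddPart_le (hn : ‖x‖ ≤ 1) (b : A) : ‖oddPart x b‖ ≤ ‖b‖ := by
  rw [oddPart, norm_smul, Real.norm_of_nonneg (by norm_num)]
  linarith [norm_sub_le b (x * b * x), norm_conj_le hn b]

theorem norm_evenPart_le (hn : ‖x‖ ≤ 1) (b : A) : ‖evenPart x b‖ ≤ ‖b‖ := by
  rw [evenPart, norm_smul, Real.norm_of_nonneg (by norm_num)]
  linarith [norm_add_le b (x * b * x), norm_conj_le hn b]

theorem norm_evenPart_le_anticommutator (hn : ‖x‖ ≤ 1) (hxx : x * x = 1) (b : A) :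
    ‖evenPart x b‖ ≤ ‖x * b + b * x‖ / 2 := by
  have h : evenPart x b = (1 / 2 : ℝ) • ((x * b + b * x) * x) := by
    rw [evenPart, add_mul, mul_assoc b, hxx, mul_one, add_comm]
  rw [h, norm_smul, Real.norm_of_nonneg (by norm_num)]
  have := (norm_mul_le (x * b + b * x) x).trans (mul_le_of_le_one_right (norm_nonneg _) hn)
  linarith

end Parts

/-- A self-adjoint family satisfying the Clifford relations up to `η`, and exactly as far as
indices in `S` are involved. -/
structure ApproxClifford {A ι : Type*} [CStarAlgebra A] (S : Finset ι) (η : ℝ) (B : ι → A) :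
    Prop where
  selfAdjoint : ∀ i, IsSelfAdjoint (B i)
  norm_le : ∀ i, ‖B i‖ ≤ 1
  sq : ∀ i, ‖B i ^ 2 - 1‖ ≤ η
  anti : ∀ i j, i ≠ j → ‖B i * B j + B j * B i‖ ≤ η
  sq_exact : ∀ i ∈ S, B i * B i = 1
  anti_exact : ∀ i ∈ S, ∀ j, j ≠ i → B i * B j + B j * B i = 0

/-- The Clifford relations involving one more index can be made exact, at the cost of a
quadratically small increase of the error in the remaining ones. -/
theorem ApproxClifford.exists_insert {A ι : Type*} [CStarAlgebra A] [DecidableEq ι]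
    {S : Finset ι} {η : ℝ} {B : ι → A} (hB : ApproxClifford S η B) (hη : η < 1) {a : ι}
    (ha : a ∉ S) :
    ∃ B' : ι → A, ApproxClifford (insert a S) (η + 9 / 2 * η ^ 2) B' ∧
      ∀ i, ‖B i - B' i‖ ≤ 3 / 2 * η := by
  obtain ⟨x, hx, hxx, hdist, hanti⟩ :=
    exists_isSelfAdjoint_involution_near (hB.selfAdjoint a) hη (hB.sq a)
  have hη0 : 0 ≤ η := (norm_nonneg _).trans (hB.sq a)
  have hn := norm_le_one_of_involution hx hxx
  have hxS : ∀ i ∈ S, B i * x + x * B i = 0 := fun i hi =>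
    hanti _ (hB.anti_exact i hi a fun h => ha (h ▸ hi))
  have heven : ∀ j, j ≠ a → ‖evenPart x (B j)‖ ≤ 3 / 2 * η := by
    intro j hj
    have h1 : x * B j + B j * x
        = (B a * B j + B j * B a) - ((B a - x) * B j + B j * (B a - x)) := by noncomm_ring
    have h2 : ‖(B a - x) * B j‖ ≤ η :=
      (norm_mul_le _ _).trans <| (mul_le_of_le_one_right (norm_nonneg _) (hB.norm_le j)).trans hdist
    have h3 : ‖B j * (B a - x)‖ ≤ η :=
      (norm_mul_le _ _).trans <| (mul_le_of_le_one_left (norm_nonneg _) (hB.norm_le j)).trans hdist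
    have h4 := norm_sub_le (B a * B j + B j * B a) ((B a - x) * B j + B j * (B a - x))
    have h5 := norm_add_le ((B a - x) * B j) (B j * (B a - x))
    have h6 := norm_evenPart_le_anticommutator hn hxx (B j)
    rw [h1] at h6
    linarith [hB.anti a j hj.symm]
  have hmul : ∀ i j, i ≠ a → j ≠ a →
      ‖evenPart x (B i) * evenPart x (B j)‖ ≤ 9 / 4 * η ^ 2 := fun i j hi hj =>
    calc _ ≤ ‖evenPart x (B i)‖ * ‖evenPart x (B j)‖ := norm_mul_le _ _
      _ ≤ (3 / 2 * η) * (3 / 2 * η) := by gcongr <;> exact heven _ ‹_›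
      _ = _ := by ring
  set B' : ι → A := Function.update (fun j => oddPart x (B j)) a x with hB'
  have hself : B' a = x := Function.update_self ..
  have hother : ∀ j, j ≠ a → B' j = oddPart x (B j) := fun j hj => Function.update_of_ne hj ..
  have hS : ∀ i ∈ S, B' i = B i := fun i hi => by
    rw [hother i fun h => ha (h ▸ hi)]
    exact oddPart_eq_self hxx (by rw [add_comm]; exact hxS i hi)
  have hanti_a : ∀ j, j ≠ a → x * B' j + B' j * x = 0 := fun j hj => by
    rw [hother j hj]
    exact anticommute_oddPart hxx _
  refine ⟨B', ⟨fun i => ?_, fun i => ?_, fun i => ?_, fun i j hij => ?_, fun i hi => ?_,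
    fun i hi j hij => ?_⟩, fun i => ?_⟩
  · by_cases h : i = a
    · rw [h, hself]; exact hx
    · rw [hother i h]; exact isSelfAdjoint_oddPart hx (hB.selfAdjoint i)
  · by_cases h : i = a
    · rw [h, hself]; exact hn
    · rw [hother i h]; exact (norm_oddPart_le hn _).trans (hB.norm_le i)
  · by_cases h : i = a
    · rw [h, hself, pow_two, hxx, sub_self, norm_zero]; positivity
    · have h1 : oddPart x (B i) ^ 2 - 1
          = evenPart x (B i ^ 2 - 1) - evenPart x (B i) * evenPart x (B i) := by
        rw [evenPart_sub, evenPart_one hxx, pow_two (B i),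
          ← oddPart_mul_add_evenPart_mul hxx, pow_two]
        abel
      rw [hother i h, h1]
      have h2 := norm_sub_le (evenPart x (B i ^ 2 - 1)) (evenPart x (B i) * evenPart x (B i))
      have h3 := (norm_evenPart_le hn (B i ^ 2 - 1)).trans (hB.sq i)
      nlinarith [hmul i i h h]
  · by_cases hi : i = a
    · have hj : j ≠ a := fun h => hij (hi.trans h.symm)
      rw [hi, hself, hanti_a j hj, norm_zero]; positivity
    by_cases hj : j = a
    · rw [hj, hself, add_comm, hanti_a i hi, norm_zero]; positivity
    have h1 : oddPart x (B i) * oddPart x (B j) + oddPart x (B j) * oddPart x (B i)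
        = evenPart x (B i * B j + B j * B i) -
          (evenPart x (B i) * evenPart x (B j) + evenPart x (B j) * evenPart x (B i)) := by
      rw [evenPart_add, ← oddPart_mul_add_evenPart_mul hxx, ← oddPart_mul_add_evenPart_mul hxx]
      abel
    rw [hother i hi, hother j hj, h1]
    have h2 := norm_sub_le (evenPart x (B i * B j + B j * B i))
      (evenPart x (B i) * evenPart x (B j) + evenPart x (B j) * evenPart x (B i))
    have h3 := (norm_evenPart_le hn (B i * B j + B j * B i)).trans (hB.anti i j hij)
    have h4 := norm_add_le (evenPart x (B i) * evenPart x (B j))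
      (evenPart x (B j) * evenPart x (B i))
    linarith [hmul i j hi hj, hmul j i hj hi]
  · rcases Finset.mem_insert.1 hi with rfl | hi
    · rw [hself, hxx]
    · rw [hS i hi]; exact hB.sq_exact i hi
  · rcases Finset.mem_insert.1 hi with rfl | hi
    · rw [hself]; exact hanti_a j hij
    · rw [hS i hi]
      by_cases hj : j = a
      · rw [hj, hself]; exact hxS i hi
      · rw [hother j hj]
        exact anticommute_oddPart_of_anticommute (hxS i hi) (hB.anti_exact i hi j hij)
  · by_cases h : i = a
    · rw [h, hself]; linarith
    · rw [hother i h, sub_oddPart]; exact heven i h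

theorem ApproxClifford.mono {A ι : Type*} [CStarAlgebra A] {S : Finset ι} {η η' : ℝ} {B : ι → A}
    (hB : ApproxClifford S η B) (h : η ≤ η') : ApproxClifford S η' B :=
  { hB with
    sq := fun i => (hB.sq i).trans h
    anti := fun i j hij => (hB.anti i j hij).trans h }

/-- The Clifford relations can be made exact on any set of at most `n` indices. -/
theorem ApproxClifford.exists_exact {A ι : Type*} [CStarAlgebra A] [DecidableEq ι]
    {n : ℕ} {ε : ℝ} {B : ι → A} (hn : 1 ≤ n) (hε0 : 0 < ε) (hε : n * ε < 1 / 250)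
    (hB : ApproxClifford ∅ ε B) (S : Finset ι) (hS : S.card ≤ n) :
    ∃ B' : ι → A, ApproxClifford S (ε * (1 + S.card / (2 * n))) B' ∧
      ∀ i, ‖B i - B' i‖ ≤ 9 / 4 * S.card * ε := by
  induction S using Finset.induction_on with
  | empty => exact ⟨B, by simpa using hB, by simp⟩
  | insert a S ha ih =>
    rw [Finset.card_insert_of_notMem ha] at hS ⊢
    obtain ⟨C, hC, hCB⟩ := ih (by omega)
    have hn0 : (1 : ℝ) ≤ n := by exact_mod_cast hn
    have hnpos : (0 : ℝ) < n := by linarith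
    have hk : (S.card : ℝ) + 1 ≤ n := by exact_mod_cast hS
    have hεn : ε ≤ n * ε := le_mul_of_one_le_left hε0.le hn0
    set η := ε * (1 + S.card / (2 * n)) with hη
    have hη0 : 0 ≤ η := by positivity
    have hη1 : η ≤ 3 / 2 * ε := by
      have : (S.card : ℝ) / (2 * n) ≤ 1 / 2 := by
        rw [div_le_iff₀ (by positivity)]
        linarith
      nlinarith
    obtain ⟨C', hC', hdist⟩ := hC.exists_insert (by linarith) ha
    refine ⟨C', hC'.mono ?_, fun i => ?_⟩
    · have h1 : ε * (1 + ((S.card + 1 : ℕ) : ℝ) / (2 * n)) = η + ε / (2 * n) := by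
        rw [hη]; push_cast; ring
      rw [h1, add_le_add_iff_left, le_div_iff₀ (by positivity)]
      have h2 : η ^ 2 ≤ 9 / 4 * ε ^ 2 := by nlinarith
      have h3 : η ^ 2 * n ≤ 9 / 4 * ε ^ 2 * n := by gcongr
      nlinarith [mul_lt_mul_of_pos_left hε hε0]
    · have := norm_sub_le_norm_sub_add_norm_sub (B i) (C i) (C' i)
      push_cast
      linarith [hCB i, hdist i]

/-- stability of the Clifford relations: an `ε`-approximate
representation of the rank-`n` Clifford algebra on `ℂ^d` (with
`0 < ε < 1/(250 n²)`) is within `5n²ε/2` of an exact representation. -/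
theorem clifford_relations_stable {n d : ℕ} (hn : 1 ≤ n)
    (ε : ℝ) (hε0 : 0 < ε) (hε : ε < 1 / (250 * n ^ 2))
    (B : Fin n → Matrix (Fin d) (Fin d) ℂ)
    (hherm : ∀ i, (B i).IsHermitian)
    (hnorm : ∀ i, opNorm (B i) ≤ 1)
    (hsq : ∀ i, opNorm ((B i) ^ 2 - 1) ≤ ε)
    (hanti : ∀ i j, i ≠ j → opNorm (B i * B j + B j * B i) ≤ ε) :
    ∃ B' : Fin n → Matrix (Fin d) (Fin d) ℂ,
      (∀ i, (B' i).IsHermitian) ∧ (∀ i, (B' i) ^ 2 = 1) ∧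
      (∀ i j, i ≠ j → B' i * B' j = -(B' j * B' i)) ∧
      (∀ i, opNorm (B i - B' i) ≤ 5 * n ^ 2 * ε / 2) := by
  have hn0 : (1 : ℝ) ≤ n := by exact_mod_cast hn
  have hεn : n * ε < 1 / 250 := by
    rw [lt_div_iff₀ (by positivity)] at hε
    nlinarith [mul_nonneg hε0.le (mul_nonneg (by linarith : (0 : ℝ) ≤ n) (sub_nonneg.2 hn0))]
  open scoped Matrix.Norms.L2Operator in
  have hB : ApproxClifford ∅ ε B :=
    ⟨hherm, hnorm, hsq, hanti, by simp, by simp⟩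
  obtain ⟨B', hB', hd⟩ := hB.exists_exact hn hε0 hεn Finset.univ (by simp)
  refine ⟨B', hB'.selfAdjoint, fun i => ?_, fun i j hij => ?_, fun i => (hd i).trans ?_⟩
  · rw [pow_two]
    exact hB'.sq_exact i (Finset.mem_univ i)
  · exact eq_neg_of_add_eq_zero_left (hB'.anti_exact i (Finset.mem_univ i) j hij.symm)
  · rw [Finset.card_univ, Fintype.card_fin]
    nlinarith [mul_nonneg hε0.le (mul_nonneg (by linarith : (0 : ℝ) ≤ n) (sub_nonneg.2 hn0)),
      mul_pos hε0 (by linarith : (0 : ℝ) < n)]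
end
end

section
/- Let H be a finite simple graph on vertex set {1,…,v} with e ≥ 1 edges, and let A_H be the associated 2e×v XOR game. Then a real positive semidefinite v×v matrix V with V_{jj} = 1 for all j is an optimal solution of (Γ) for A_H if and only if V_{ij} = 0 for every edge {i,j} of H; and the optimum value of (Γ) for A_H equals 1/√2. -/
open scoped BigOperators RealInnerProductSpace
open Matrix Kronecker

noncomputable section

/-- Row index type for the XOR game associated to a graph `H`: one ordered edge
`(i,j)` with `i < j` together with a boolean choosing one of the two rows. -/
def GraphRow {v : ℕ} (H : SimpleGraph (Fin v)) [DecidableRel H.Adj] : Type :=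
  {p : Fin v × Fin v // p.1 < p.2 ∧ H.Adj p.1 p.2} × Bool

instance {v : ℕ} (H : SimpleGraph (Fin v)) [DecidableRel H.Adj] :
    Fintype (GraphRow H) := by
  unfold GraphRow; infer_instance

/-- The XOR game `A_H` associated to a graph `H` with `e` edges: for each edge
`{i,j}` (`i < j`), one row with entries `1/(4e)` at `i` and `−1/(4e)` at `j`, and
one row with entries `1/(4e)` at both `i` and `j`. -/
def graphGame {v : ℕ} (H : SimpleGraph (Fin v)) [DecidableRel H.Adj] (e : ℕ) :
    Matrix (GraphRow H) (Fin v) ℝ :=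
  fun r k =>
    if k = r.1.1.1 then 1 / (4 * e)
    else if k = r.1.1.2 then (if r.2 then 1 / (4 * e) else -(1 / (4 * e)))
    else 0


/-- The value of the two-point weight `a` at `i`, `b` at `j` against a function. -/
lemma sum_ite_ite_mul {κ : Type*} [Fintype κ] [DecidableEq κ] {i j : κ} (hij : i ≠ j)
    (a b : ℝ) (f : κ → ℝ) :
    ∑ k, (if k = i then a else if k = j then b else 0) * f k = a * f i + b * f j := by
  have h : ∀ k, (if k = i then a else if k = j then b else 0) * f k =
      (if k = i then a * f k else 0) + (if k = j then b * f k else 0) := by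
    intro k
    by_cases h1 : k = i
    · subst h1; simp [hij]
    · simp [h1]
  simp [h, Finset.sum_add_distrib]

/-- The quadratic form of a row of the graph game. -/
lemma graphGame_row_sum {v : ℕ} (H : SimpleGraph (Fin v)) [DecidableRel H.Adj] (e : ℕ)
    {V : Matrix (Fin v) (Fin v) ℝ} (hV : V.PosSemidef) (h1 : ∀ j, V j j = 1)
    (r : GraphRow H) :
    ∑ j, ∑ k, graphGame H e r j * graphGame H e r k * V j k =
      (1 / (4 * e)) ^ 2 * (2 + (if r.2 then 2 else -2) * V r.1.1.1 r.1.1.2) := by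
  have hne : r.1.1.1 ≠ r.1.1.2 := r.1.2.1.ne
  have hsymm : V r.1.1.2 r.1.1.1 = V r.1.1.1 r.1.1.2 := by
    simpa using hV.1.apply r.1.1.1 r.1.1.2
  simp only [mul_assoc, ← Finset.mul_sum]
  simp only [graphGame, sum_ite_ite_mul hne, h1, hsymm]
  split_ifs <;> ring

/-- A positive semidefinite matrix has nonnegative quadratic form on rows. -/
lemma PosSemidef.row_sum_nonneg {ι κ : Type*} [Fintype κ] (G : Matrix ι κ ℝ)
    {V : Matrix κ κ ℝ} (hV : V.PosSemidef) (r : ι) :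
    0 ≤ ∑ j, ∑ k, G r j * G r k * V j k := by
  have h := hV.dotProduct_mulVec_nonneg (G r)
  simp only [dotProduct, mulVec, Finset.mul_sum, Pi.star_apply, star_trivial] at h
  refine h.trans_eq (Finset.sum_congr rfl fun j _ => Finset.sum_congr rfl fun k _ => ?_)
  ring

/-- The number of increasing edge pairs is the number of edges. -/
lemma card_increasing_pairs {v : ℕ} (H : SimpleGraph (Fin v)) [DecidableRel H.Adj] :
    Fintype.card {p : Fin v × Fin v // p.1 < p.2 ∧ H.Adj p.1 p.2} = H.edgeFinset.card := by
  rw [SimpleGraph.edgeFinset_card]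
  refine Fintype.card_of_bijective
    (f := fun p => (⟨s(p.1.1, p.1.2), p.2.2⟩ : H.edgeSet)) ⟨?_, ?_⟩
  · rintro ⟨⟨a, b⟩, hab, _⟩ ⟨⟨c, d⟩, hcd, _⟩ h
    rcases Sym2.eq_iff.mp (congrArg Subtype.val h) with ⟨rfl, rfl⟩ | ⟨rfl, rfl⟩
    · rfl
    · exact absurd hab (lt_asymm hcd)
  · rintro ⟨q, hq⟩
    induction q with
    | _ a b =>
      have hab : H.Adj a b := hq
      rcases lt_or_gt_of_ne hab.ne with h | h
      · exact ⟨⟨(a, b), h, hab⟩, rfl⟩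
      · exact ⟨⟨(b, a), h, hab.symm⟩, Subtype.ext Sym2.eq_swap⟩

/-- The objective of (Γ) for a graph game, as a sum over edges. -/
lemma gammaObj_graphGame {v : ℕ} (H : SimpleGraph (Fin v)) [DecidableRel H.Adj] (e : ℕ)
    {V : Matrix (Fin v) (Fin v) ℝ} (hV : V.PosSemidef) (h1 : ∀ j, V j j = 1) :
    gammaObj (graphGame H e) V =
      ∑ p : {p : Fin v × Fin v // p.1 < p.2 ∧ H.Adj p.1 p.2}, 1 / (4 * e) *
        (√(2 + 2 * V p.1.1 p.1.2) + √(2 - 2 * V p.1.1 p.1.2)) := by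
  unfold gammaObj
  simp only [graphGame_row_sum H e hV h1]
  refine (Fintype.sum_prod_type
    (fun r : {p : Fin v × Fin v // p.1 < p.2 ∧ H.Adj p.1 p.2} × Bool =>
    √((1 / (4 * (e : ℝ))) ^ 2 * (2 + (if r.2 then 2 else -2) * V r.1.1.1 r.1.1.2)))).trans ?_
  refine Finset.sum_congr rfl fun p _ => ?_
  have hc : (0 : ℝ) ≤ 1 / (4 * e) := by positivity
  simp only [Fintype.sum_bool, Real.sqrt_mul (sq_nonneg _), Real.sqrt_sq hc, if_true,
    Bool.false_eq_true, if_false]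
  rw [mul_add, neg_mul, ← sub_eq_add_neg]

/-- Each off-diagonal entry of a feasible matrix has absolute value at most one. -/
lemma PosSemidef.abs_apply_le_one {κ : Type*} [Fintype κ] [DecidableEq κ]
    {V : Matrix κ κ ℝ} (hV : V.PosSemidef) (h1 : ∀ j, V j j = 1) {i j : κ} (hij : i ≠ j) :
    |V i j| ≤ 1 := by
  have hsymm : V j i = V i j := by simpa using hV.1.apply i j
  have key : ∀ b : ℝ, 0 ≤ 1 + 2 * b * V i j + b ^ 2 := by
    intro b
    have h := PosSemidef.row_sum_nonneg
      (fun _ k => if k = i then 1 else if k = j then b else 0 : Matrix Unit κ ℝ) hV ()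
    simp only [mul_assoc, ← Finset.mul_sum, sum_ite_ite_mul hij, h1, hsymm] at h
    linarith
  rw [abs_le]
  constructor
  · linarith [key 1]
  · linarith [key (-1)]

lemma sqrt_add_sqrt_le {x : ℝ} (hx : |x| ≤ 1) :
    √(2 + 2 * x) + √(2 - 2 * x) ≤ 2 * √2 := by
  obtain ⟨h1, h2⟩ := abs_le.mp hx
  have hs := Real.sq_sqrt (show 0 ≤ 2 + 2 * x by linarith)
  have ht := Real.sq_sqrt (show 0 ≤ 2 - 2 * x by linarith)
  have h := Real.sq_sqrt (show (0 : ℝ) ≤ 2 by norm_num)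
  refine abs_le_of_sq_le_sq' ?_ (by positivity) |>.2
  nlinarith [sq_nonneg (√(2 + 2 * x) - √(2 - 2 * x))]

lemma sqrt_add_sqrt_eq_iff {x : ℝ} (hx : |x| ≤ 1) :
    √(2 + 2 * x) + √(2 - 2 * x) = 2 * √2 ↔ x = 0 := by
  constructor
  · intro heq
    obtain ⟨h1, h2⟩ := abs_le.mp hx
    have hs := Real.sq_sqrt (show 0 ≤ 2 + 2 * x by linarith)
    have ht := Real.sq_sqrt (show 0 ≤ 2 - 2 * x by linarith)
    have h := Real.sq_sqrt (show (0 : ℝ) ≤ 2 by norm_num)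
    have hsq : (√(2 + 2 * x) - √(2 - 2 * x)) ^ 2 = 0 := by
      have hs2 : (√(2 + 2 * x) + √(2 - 2 * x)) ^ 2 = (2 * √2) ^ 2 := by rw [heq]
      nlinarith
    have hst : √(2 + 2 * x) = √(2 - 2 * x) := 
      sub_eq_zero.mp (pow_eq_zero_iff two_ne_zero |>.mp hsq)
    rw [hst] at hs
    linarith
  · rintro rfl
    simp [two_mul]

/-- Summing the maximal contribution of an edge over all edges gives `1/√2`. -/
lemma sum_const_edges {v : ℕ} (H : SimpleGraph (Fin v)) [DecidableRel H.Adj]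
    (he : 1 ≤ H.edgeFinset.card) :
    ∑ _p : {p : Fin v × Fin v // p.1 < p.2 ∧ H.Adj p.1 p.2},
      1 / (4 * (H.edgeFinset.card : ℝ)) * (2 * √2) = 1 / √2 := by
  have he' : (H.edgeFinset.card : ℝ) ≠ 0 := by positivity
  have h := Real.mul_self_sqrt (show (0 : ℝ) ≤ 2 by norm_num)
  rw [Finset.sum_const, Finset.card_univ, card_increasing_pairs, nsmul_eq_mul]
  field_simp
  linarith

lemma gammaObj_graphGame_le {v : ℕ} (H : SimpleGraph (Fin v)) [DecidableRel H.Adj]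
    (he : 1 ≤ H.edgeFinset.card) {V : Matrix (Fin v) (Fin v) ℝ} (hV : V.PosSemidef)
    (h1 : ∀ j, V j j = 1) : gammaObj (graphGame H H.edgeFinset.card) V ≤ 1 / √2 := by
  rw [gammaObj_graphGame H _ hV h1, ← sum_const_edges H he]
  refine Finset.sum_le_sum fun p _ => mul_le_mul_of_nonneg_left ?_ (by positivity)
  exact sqrt_add_sqrt_le (PosSemidef.abs_apply_le_one hV h1 p.2.1.ne)

lemma gammaObj_graphGame_eq_iff {v : ℕ} (H : SimpleGraph (Fin v)) [DecidableRel H.Adj]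
    (he : 1 ≤ H.edgeFinset.card) {V : Matrix (Fin v) (Fin v) ℝ} (hV : V.PosSemidef)
    (h1 : ∀ j, V j j = 1) : gammaObj (graphGame H H.edgeFinset.card) V = 1 / √2 ↔
      ∀ i j, H.Adj i j → V i j = 0 := by
  have hc : (0 : ℝ) < 1 / (4 * (H.edgeFinset.card : ℝ)) := by positivity
  rw [gammaObj_graphGame H _ hV h1, ← sum_const_edges H he, Finset.sum_eq_sum_iff_of_le
    fun p _ => mul_le_mul_of_nonneg_left
      (sqrt_add_sqrt_le (PosSemidef.abs_apply_le_one hV h1 p.2.1.ne)) hc.le]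
  simp only [Finset.mem_univ, true_imp_iff, mul_right_inj' hc.ne']
  constructor
  · intro h i j hij
    rcases lt_or_gt_of_ne hij.ne with hlt | hlt
    · exact (sqrt_add_sqrt_eq_iff (PosSemidef.abs_apply_le_one hV h1 hij.ne)).mp
        (h ⟨(i, j), hlt, hij⟩)
    · have hsymm : V i j = V j i := by simpa using hV.1.apply j i
      rw [hsymm]
      exact (sqrt_add_sqrt_eq_iff (PosSemidef.abs_apply_le_one hV h1 hij.ne')).mp
        (h ⟨(j, i), hlt, hij.symm⟩)
  · intro h p
    exact (sqrt_add_sqrt_eq_iff (PosSemidef.abs_apply_le_one hV h1 p.2.1.ne)).mpr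
      (h _ _ p.2.2)

/-- for the graph game `A_H` (`e ≥ 1` edges), a feasible `V`
is optimal for (Γ) iff `V i j = 0` for every edge `{i,j}` of `H`, and the optimum
value of (Γ) is `1/√2`. -/
theorem graphGame_gamma_solutions {v : ℕ} (H : SimpleGraph (Fin v))
    [DecidableRel H.Adj] (he : 1 ≤ H.edgeFinset.card) :
    (∀ V : Matrix (Fin v) (Fin v) ℝ, V.PosSemidef → (∀ j, V j j = 1) →
      (gammaOptimal (graphGame H H.edgeFinset.card) V ↔
        ∀ i j, H.Adj i j → V i j = 0)) ∧
    IsGreatest {x : ℝ | ∃ V : Matrix (Fin v) (Fin v) ℝ,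
        V.PosSemidef ∧ (∀ j, V j j = 1) ∧
        gammaObj (graphGame H H.edgeFinset.card) V = x}
      (1 / Real.sqrt 2) := by
  have hone : (1 : Matrix (Fin v) (Fin v) ℝ).PosSemidef := Matrix.PosSemidef.one
  have hdiag : ∀ j, (1 : Matrix (Fin v) (Fin v) ℝ) j j = 1 := fun j => Matrix.one_apply_eq j
  have hval : gammaObj (graphGame H H.edgeFinset.card) 1 = 1 / √2 :=
    (gammaObj_graphGame_eq_iff H he hone hdiag).mpr fun i j hij => Matrix.one_apply_ne hij.ne
  refine ⟨fun V hV h1 => ?_, ⟨1, hone, hdiag, hval⟩, ?_⟩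
  · rw [← gammaObj_graphGame_eq_iff H he hV h1]
    constructor
    · rintro ⟨_, _, hmax⟩
      exact le_antisymm (gammaObj_graphGame_le H he hV h1) (hval ▸ hmax 1 hone hdiag)
    · intro h
      exact ⟨hV, h1, fun W hW hW1 => h ▸ gammaObj_graphGame_le H he hW hW1⟩
  · rintro x ⟨V, hV, h1, rfl⟩
    exact gammaObj_graphGame_le H he hV h1
end
end
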